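/- arXiv:1710.10988 — 2 statements merged into one kernel-verified Lean document; each statement's English description precedes it below -/
import Mathlib

section
/- Fix α > 0 with α ≠ 1, n ≥ 1, and a homogeneous Calderón–Zygmund kernel K as below. There exists γ > 0 (depending on n, α, K, Δ) such that for all integers j, ℓ ≥ 0 and all ξ ∈ ℝ^n, (Σ_{k∈ℤ} |Δ̂(2^{−k+ℓ+j}ξ) m̃_ℓ(2^{−k+ℓ}ξ)|²)^{1/2} + (Σ_{k∈ℤ} |Δ̂(2^{−k+ℓ−j}ξ) m_ℓ(2^{−k+ℓ}ξ)|²)^{1/2} ≲ 2^{−γ(ℓ+j)}. -/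
open MeasureTheory Filter Set Metric
open scoped ENNReal NNReal RealInnerProductSpace Topology

noncomputable section

/-- Euclidean space ℝ^n. -/
abbrev En (n : ℕ) := EuclideanSpace ℝ (Fin n)

/-- The kernel K(x) = Ω(x)/|x|^n. -/
def czKernel (n : ℕ) (Ω : En n → ℝ) (x : En n) : ℝ := Ω x / ‖x‖ ^ n

/-- The Fourier transform ĝ(ξ) = ∫ e^{-ix·ξ} g(x) dx. -/
def ftP (n : ℕ) (g : En n → ℂ) (ξ : En n) : ℂ :=
  ∫ x : En n, Complex.exp (-Complex.I * ((⟪x, ξ⟫ : ℝ) : ℂ)) * g x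

/-- Δ(x) = 2^n S(2x) − S(x). -/
def DeltaFn (n : ℕ) (S : En n → ℝ) (x : En n) : ℝ := 2 ^ n * S ((2 : ℝ) • x) - S x

/-- The multipliers m_ℓ. -/
def mMul (n : ℕ) (α : ℝ) (Ω : En n → ℝ) (ℓ : ℕ) (ξ : En n) : ℂ :=
  if ℓ = 0 then
    ∫ t in {t : En n | ‖t‖ ≤ 1},
      (Complex.exp (Complex.I * ((‖t‖ ^ α : ℝ) : ℂ)) - 1) *
        Complex.exp (-Complex.I * ((⟪t, ξ⟫ : ℝ) : ℂ)) * (czKernel n Ω t : ℂ)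
  else
    ∫ t in {t : En n | 1 / 2 < ‖t‖ ∧ ‖t‖ ≤ 1},
      Complex.exp (Complex.I * ((((2 : ℝ) ^ ℓ * ‖t‖) ^ α : ℝ) : ℂ)) *
        Complex.exp (-Complex.I * ((⟪t, ξ⟫ : ℝ) : ℂ)) * (czKernel n Ω t : ℂ)

/-- The multipliers m̃_ℓ. -/
def mMulTilde (n : ℕ) (α : ℝ) (Ω : En n → ℝ) (ℓ : ℕ) (ξ : En n) : ℂ :=
  if ℓ = 0 then
    ∫ t in {t : En n | ‖t‖ ≤ 1},
      (Complex.exp (Complex.I * ((‖t‖ ^ α : ℝ) : ℂ)) - 1) *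
        (Complex.exp (-Complex.I * ((⟪t, ξ⟫ : ℝ) : ℂ)) - 1) * (czKernel n Ω t : ℂ)
  else
    ∫ t in {t : En n | 1 / 2 < ‖t‖ ∧ ‖t‖ ≤ 1},
      Complex.exp (Complex.I * ((((2 : ℝ) ^ ℓ * ‖t‖) ^ α : ℝ) : ℂ)) *
        (Complex.exp (-Complex.I * ((⟪t, ξ⟫ : ℝ) : ℂ)) - 1) * (czKernel n Ω t : ℂ)

/-- Second-derivative van der Corput estimate with a differentiable amplitude. -/
lemma norm_integral_exp_le_of_second_deriv {a b : ℝ} (hab : a ≤ b) {φ φ₁ φ₂ w w₁ : ℝ → ℝ}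
    {s μ W W₁ : ℝ} (hs : s = 1 ∨ s = -1) (hμ : 0 < μ)
    (hφ : ∀ r ∈ Icc a b, HasDerivAt φ (φ₁ r) r) (hφ₁ : ∀ r ∈ Icc a b, HasDerivAt φ₁ (φ₂ r) r)
    (hw : ∀ r ∈ Icc a b, HasDerivAt w (w₁ r) r) (hφ₂ : ContinuousOn φ₂ (Icc a b))
    (hw₁ : ContinuousOn w₁ (Icc a b)) (hlow : ∀ r ∈ Icc a b, μ ≤ s * φ₂ r)
    (hW : ∀ r ∈ Icc a b, |w r| ≤ W) (hW₁ : ∀ r ∈ Icc a b, |w₁ r| ≤ W₁) :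
    ‖∫ r in a..b, Complex.exp (Complex.I * (φ r : ℂ)) * (w r : ℂ)‖ ≤
      (W * (1 + 2 * Real.pi) + W₁ * (b - a)) / √μ := by
  set κ := √μ with hκdef
  have hκ : 0 < κ := Real.sqrt_pos.2 hμ
  have hκ2 : κ ^ 2 = μ := Real.sq_sqrt hμ.le
  have hQ : ∀ r, 0 < φ₁ r ^ 2 + κ ^ 2 := fun r => by positivity
  have hW0 : 0 ≤ W := (abs_nonneg _).trans (hW a ⟨le_rfl, hab⟩)
  have hW10 : 0 ≤ W₁ := (abs_nonneg _).trans (hW₁ a ⟨le_rfl, hab⟩)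
  let e : ℝ → ℂ := fun r => Complex.exp (Complex.I * (φ r : ℂ))
  have he : ∀ r, ‖e r‖ = 1 := fun r => by
    simp only [e]; rw [mul_comm]; exact Complex.norm_exp_ofReal_mul_I _
  let q : ℝ → ℝ := fun r => φ₁ r / (φ₁ r ^ 2 + κ ^ 2)
  let q₁ : ℝ → ℝ := fun r => φ₂ r * (κ ^ 2 - φ₁ r ^ 2) / (φ₁ r ^ 2 + κ ^ 2) ^ 2
  have hq : ∀ r ∈ Icc a b, HasDerivAt q (q₁ r) r := fun r hr => by
    have h := (hφ₁ r hr).div (((hφ₁ r hr).pow 2).add_const (κ ^ 2)) (hQ r).ne'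
    refine h.congr_deriv ?_
    simp only [q₁]; congr 1
    simp; ring
  have hqb : ∀ r, |q r| ≤ 1 / (2 * κ) := fun r => by
    simp only [q]
    rw [abs_div, abs_of_pos (hQ r), div_le_div_iff₀ (hQ r) (by positivity)]
    nlinarith [sq_nonneg (|φ₁ r| - κ), sq_abs (φ₁ r)]
  have hdom : ∀ r ∈ Icc a b, |q₁ r| ≤ s * φ₂ r / (φ₁ r ^ 2 + κ ^ 2) := fun r hr => by
    have hp : 0 < s * φ₂ r := hμ.trans_le (hlow r hr)
    have habs : |φ₂ r| = s * φ₂ r := by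
      rcases hs with rfl | rfl
      · rw [one_mul] at hp ⊢; exact abs_of_pos hp
      · rw [abs_of_neg (by linarith)]; ring
    simp only [q₁]
    rw [abs_div, abs_mul, habs, abs_of_pos (pow_pos (hQ r) 2), div_le_div_iff₀ (pow_pos (hQ r) 2) (hQ r)]
    have : |κ ^ 2 - φ₁ r ^ 2| ≤ φ₁ r ^ 2 + κ ^ 2 := by
      rw [abs_le]; constructor <;> nlinarith [sq_nonneg (φ₁ r), sq_nonneg κ]
    calc s * φ₂ r * |κ ^ 2 - φ₁ r ^ 2| * (φ₁ r ^ 2 + κ ^ 2)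
        ≤ s * φ₂ r * (φ₁ r ^ 2 + κ ^ 2) * (φ₁ r ^ 2 + κ ^ 2) := by
          have := (hQ r).le
          gcongr
      _ = _ := by ring
  let R : ℝ → ℂ := fun r => Complex.I * e r * ((w₁ r * q r + w r * q₁ r : ℝ) : ℂ) +
    e r * ((w r * (κ ^ 2 / (φ₁ r ^ 2 + κ ^ 2)) : ℝ) : ℂ)
  let F : ℝ → ℂ := fun r => e r * ((w r * q r : ℝ) : ℂ) * (-Complex.I)
  let G : ℝ → ℝ := fun r => W₁ / (2 * κ) * r + 2 * W * s / κ * Real.arctan (φ₁ r / κ)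
  let G₁ : ℝ → ℝ := fun r => W₁ / (2 * κ) + 2 * W * (s * φ₂ r / (φ₁ r ^ 2 + κ ^ 2))
  have hcφ : ContinuousOn φ (Icc a b) := fun r hr => (hφ r hr).continuousAt.continuousWithinAt
  have hcφ₁ : ContinuousOn φ₁ (Icc a b) := fun r hr => (hφ₁ r hr).continuousAt.continuousWithinAt
  have hcw : ContinuousOn w (Icc a b) := fun r hr => (hw r hr).continuousAt.continuousWithinAt
  have hcq : ContinuousOn q (Icc a b) := fun r hr => (hq r hr).continuousAt.continuousWithinAt
  have hce : ContinuousOn e (Icc a b) := by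
    simp only [e]
    exact Complex.continuous_exp.comp_continuousOn
      (continuousOn_const.mul (Complex.continuous_ofReal.comp_continuousOn hcφ))
  have hcq₁ : ContinuousOn q₁ (Icc a b) := by
    simp only [q₁]
    exact (hφ₂.mul (continuousOn_const.sub (hcφ₁.pow 2))).div (((hcφ₁.pow 2).add
      continuousOn_const).pow 2) fun r _ => (pow_pos (hQ r) 2).ne'
  have hcR : ContinuousOn R (Icc a b) := by
    refine ((continuousOn_const.mul hce).mul (Complex.continuous_ofReal.comp_continuousOn
      ((hw₁.mul hcq).add (hcw.mul hcq₁)))).add (hce.mul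
        (Complex.continuous_ofReal.comp_continuousOn (hcw.mul (continuousOn_const.div
          ((hcφ₁.pow 2).add continuousOn_const) fun r _ => (hQ r).ne'))))
  have hcG₁ : ContinuousOn G₁ (Icc a b) :=
    continuousOn_const.add (continuousOn_const.mul ((continuousOn_const.mul hφ₂).div
      ((hcφ₁.pow 2).add continuousOn_const) fun r _ => (hQ r).ne'))
  have hF : ∀ r ∈ Icc a b, HasDerivAt F (e r * (w r : ℂ) - R r) r := fun r hr => by
    have he' : HasDerivAt e (e r * (Complex.I * (φ₁ r : ℂ))) r :=
      ((hφ r hr).ofReal_comp.const_mul Complex.I).cexp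
    have hu : HasDerivAt (fun r => ((w r * q r : ℝ) : ℂ)) ((w₁ r * q r + w r * q₁ r : ℝ) : ℂ) r :=
      ((hw r hr).mul (hq r hr)).ofReal_comp
    refine ((he'.mul hu).mul_const (-Complex.I)).congr_deriv ?_
    have hd : q r * φ₁ r + κ ^ 2 / (φ₁ r ^ 2 + κ ^ 2) = 1 := by
      simp only [q]; field_simp [(hQ r).ne']
    have hd' : (q r : ℂ) * φ₁ r + ((κ ^ 2 / (φ₁ r ^ 2 + κ ^ 2) : ℝ) : ℂ) = 1 := by
      exact_mod_cast hd
    simp only [R]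
    rw [Complex.ofReal_mul (w r) (κ ^ 2 / _), ← sub_eq_of_eq_add' hd'.symm, Complex.ofReal_mul (w r) (q r)]
    linear_combination (-(e r) * φ₁ r * w r * q r) * Complex.I_sq
  have hG : ∀ r ∈ Icc a b, HasDerivAt G (G₁ r) r := fun r hr => by
    have h1 := ((hφ₁ r hr).div_const κ).arctan
    refine (((hasDerivAt_id r).const_mul (W₁ / (2 * κ))).add
      (h1.const_mul (2 * W * s / κ))).congr_deriv ?_
    simp only [G₁]
    have := (hQ r).ne'
    have h3 : 1 + (φ₁ r / κ) ^ 2 = (φ₁ r ^ 2 + κ ^ 2) / κ ^ 2 := by field_simp; ring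
    rw [h3]
    field_simp
  have hRb : ∀ r ∈ Icc a b, ‖R r‖ ≤ G₁ r := fun r hr => by
    have hp : κ ^ 2 / (φ₁ r ^ 2 + κ ^ 2) ≤ s * φ₂ r / (φ₁ r ^ 2 + κ ^ 2) := by
      have := (hQ r).le
      have := hlow r hr
      rw [← hκ2] at this
      gcongr
    have hp0 : 0 ≤ κ ^ 2 / (φ₁ r ^ 2 + κ ^ 2) := by have := hQ r; positivity
    calc ‖R r‖ ≤ |w₁ r * q r + w r * q₁ r| + |w r * (κ ^ 2 / (φ₁ r ^ 2 + κ ^ 2))| := by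
          refine (norm_add_le _ _).trans (le_of_eq ?_)
          rw [norm_mul, norm_mul, norm_mul, he, Complex.norm_I, Complex.norm_real, Complex.norm_real]
          simp only [one_mul, Real.norm_eq_abs]
      _ ≤ (|w₁ r| * |q r| + |w r| * |q₁ r|) + |w r| * (κ ^ 2 / (φ₁ r ^ 2 + κ ^ 2)) := by
          rw [abs_mul (w r) (κ ^ 2 / _), abs_of_nonneg hp0, ← abs_mul, ← abs_mul]
          gcongr
          exact abs_add_le _ _
      _ ≤ (W₁ * (1 / (2 * κ)) + W * (s * φ₂ r / (φ₁ r ^ 2 + κ ^ 2))) +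
            W * (s * φ₂ r / (φ₁ r ^ 2 + κ ^ 2)) := by
          gcongr
          · exact hW₁ r hr
          · exact hqb r
          · exact hW r hr
          · exact hdom r hr
          · exact hW r hr
      _ = G₁ r := by simp only [G₁]; ring
  have hiR : IntervalIntegrable R volume a b := (hcR.mono (by rw [uIcc_of_le hab])).intervalIntegrable
  have hiw : IntervalIntegrable (fun r => e r * (w r : ℂ)) volume a b :=
    ((hce.mul (Complex.continuous_ofReal.comp_continuousOn hcw)).mono
      (by rw [uIcc_of_le hab])).intervalIntegrable
  have hiG : IntervalIntegrable G₁ volume a b := (hcG₁.mono (by rw [uIcc_of_le hab])).intervalIntegrable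
  have e1 : ∫ r in a..b, (e r * (w r : ℂ) - R r) = F b - F a :=
    intervalIntegral.integral_eq_sub_of_hasDerivAt
      (fun r hr => hF r (by rwa [uIcc_of_le hab] at hr)) (hiw.sub hiR)
  have e2 : ∫ r in a..b, G₁ r = G b - G a :=
    intervalIntegral.integral_eq_sub_of_hasDerivAt
      (fun r hr => hG r (by rwa [uIcc_of_le hab] at hr)) hiG
  rw [intervalIntegral.integral_sub hiw hiR] at e1
  have e3 : ‖∫ r in a..b, R r‖ ≤ G b - G a := by
    rw [← e2]
    exact intervalIntegral.norm_integral_le_of_norm_le hab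
      (Filter.Eventually.of_forall fun r hr => hRb r ⟨hr.1.le, hr.2⟩) hiG
  have hFb : ∀ r ∈ Icc a b, ‖F r‖ ≤ W * (1 / (2 * κ)) := fun r hr => by
    simp only [F]
    rw [norm_mul, norm_mul, he, norm_neg, Complex.norm_I, Complex.norm_real, Real.norm_eq_abs,
      abs_mul, one_mul, mul_one]
    gcongr
    · exact hW r hr
    · exact hqb r
  have hGb : G b - G a ≤ W₁ / (2 * κ) * (b - a) + 2 * W / κ * Real.pi := by
    have h1 := Real.arctan_lt_pi_div_two (φ₁ b / κ)
    have h2 := Real.arctan_lt_pi_div_two (φ₁ a / κ)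
    have h3 := Real.neg_pi_div_two_lt_arctan (φ₁ b / κ)
    have h4 := Real.neg_pi_div_two_lt_arctan (φ₁ a / κ)
    have h5 : s * (Real.arctan (φ₁ b / κ) - Real.arctan (φ₁ a / κ)) ≤ Real.pi := by
      rcases hs with rfl | rfl <;> linarith
    have h6 : 2 * W / κ * (s * (Real.arctan (φ₁ b / κ) - Real.arctan (φ₁ a / κ)))
      ≤ 2 * W / κ * Real.pi := by gcongr
    simp only [G]
    calc _ = W₁ / (2 * κ) * (b - a) +
        2 * W / κ * (s * (Real.arctan (φ₁ b / κ) - Real.arctan (φ₁ a / κ))) := by ring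
      _ ≤ _ := by linarith
  have e4 : (∫ r in a..b, e r * (w r : ℂ)) = (F b - F a) + ∫ r in a..b, R r := by
    rw [← e1]; ring
  change ‖∫ r in a..b, e r * (w r : ℂ)‖ ≤ _
  rw [e4]
  calc _ ≤ ‖F b‖ + ‖F a‖ + ‖∫ r in a..b, R r‖ := (norm_add_le _ _).trans (by gcongr; exact norm_sub_le _ _)
    _ ≤ W * (1 / (2 * κ)) + W * (1 / (2 * κ)) + (W₁ / (2 * κ) * (b - a) + 2 * W / κ * Real.pi) := by
        gcongr
        · exact hFb b ⟨hab, le_rfl⟩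
        · exact hFb a ⟨le_rfl, hab⟩
        · exact e3.trans hGb
    _ = (W * (1 + 2 * Real.pi) + W₁ * (b - a) / 2) / κ := by field_simp; ring
    _ ≤ _ := by
        have : 0 ≤ W₁ * (b - a) := mul_nonneg hW10 (by linarith)
        gcongr
        linarith

/-- Uniform decay of the radial oscillatory integral with phase `lam * r ^ α - c * r`. -/
lemma exists_radial_oscillatory_bound (α : ℝ) (hα : 0 < α) (hα1 : α ≠ 1) :
    ∃ C : ℝ, 0 ≤ C ∧ ∀ lam : ℝ, 0 < lam → ∀ c : ℝ,
      ‖∫ r in (1 / 2 : ℝ)..1, Complex.exp (Complex.I * ((lam * r ^ α - c * r : ℝ) : ℂ)) *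
        ((r⁻¹ : ℝ) : ℂ)‖ ≤ C / √lam := by
  set d : ℝ := |α * (α - 1)| * (1 / 2) ^ α with hd
  have hd0 : 0 < d := by
    have : α * (α - 1) ≠ 0 := mul_ne_zero hα.ne' (sub_ne_zero.2 hα1)
    positivity
  refine ⟨(2 * (1 + 2 * Real.pi) + 4 * (1 - 1 / 2)) / √d, by positivity, fun lam hlam c => ?_⟩
  have hsgn : ∃ s : ℝ, (s = 1 ∨ s = -1) ∧ s * (α * (α - 1)) = |α * (α - 1)| := by
    rcases le_total 0 (α * (α - 1)) with h | h
    · exact ⟨1, Or.inl rfl, by rw [abs_of_nonneg h, one_mul]⟩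
    · exact ⟨-1, Or.inr rfl, by rw [abs_of_nonpos h]; ring⟩
  obtain ⟨s, hs, hs'⟩ := hsgn
  have hpos : ∀ r ∈ Icc (1 / 2 : ℝ) 1, 0 < r := fun r hr => by linarith [hr.1]
  have := norm_integral_exp_le_of_second_deriv (a := 1 / 2) (b := 1) (by norm_num)
    (φ := fun r => lam * r ^ α - c * r) (φ₁ := fun r => lam * (α * r ^ (α - 1)) - c)
    (φ₂ := fun r => lam * (α * ((α - 1) * r ^ (α - 1 - 1)))) (w := fun r => r⁻¹)
    (w₁ := fun r => -(r ^ 2)⁻¹) (s := s) (μ := d * lam) (W := 2) (W₁ := 4) hs (by positivity)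
    (fun r hr => ?_) (fun r hr => ?_) (fun r hr => ?_) ?_ ?_ (fun r hr => ?_) (fun r hr => ?_)
    (fun r hr => ?_)
  · refine this.trans (le_of_eq ?_)
    rw [Real.sqrt_mul hd0.le, div_div]
  · refine (((Real.hasDerivAt_rpow_const (Or.inl (hpos r hr).ne')).const_mul lam).sub
      ((hasDerivAt_id r).const_mul c)).congr_deriv (by simp)
  · exact ((((Real.hasDerivAt_rpow_const (p := α - 1) (Or.inl (hpos r hr).ne')).const_mul α).const_mul lam).sub_const
      c).congr_deriv rfl
  · exact hasDerivAt_inv (hpos r hr).ne'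
  · refine continuousOn_const.mul (continuousOn_const.mul (continuousOn_const.mul
      (continuousOn_id.rpow_const fun r hr => Or.inl (hpos r hr).ne')))
  · exact ((continuousOn_id.pow 2).inv₀ fun r hr => (pow_pos (hpos r hr) 2).ne').neg
  · have h1 : (1 / 2 : ℝ) ^ α ≤ r ^ (α - 1 - 1) := by
      calc (1 / 2 : ℝ) ^ α ≤ r ^ α := Real.rpow_le_rpow (by norm_num) hr.1 hα.le
        _ ≤ r ^ (α - 1 - 1) := Real.rpow_le_rpow_of_exponent_ge (hpos r hr) hr.2 (by linarith)
    calc d * lam = |α * (α - 1)| * (1 / 2) ^ α * lam := rfl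
      _ ≤ |α * (α - 1)| * r ^ (α - 1 - 1) * lam := by gcongr
      _ = _ := by rw [← hs']; ring
  · rw [abs_inv, abs_of_pos (hpos r hr)]
    exact inv_le_of_inv_le₀ (by norm_num) (by have := hr.1; norm_num at this ⊢; linarith)
  · rw [abs_neg, abs_inv, abs_of_pos (pow_pos (hpos r hr) 2)]
    refine inv_le_of_inv_le₀ (by norm_num) ?_
    nlinarith [hr.1]

/-- A degree-zero homogeneous function that is smooth away from the origin is bounded there, and
Lipschitz with constant `O(1 / a)` outside the ball of radius `a`. -/
lemma exists_bound_lipschitz_of_homogeneous {n : ℕ} {Ω : En n → ℝ}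
    (hΩsmooth : ContDiffOn ℝ (⊤ : ℕ∞) Ω {x : En n | x ≠ 0})
    (hΩhom : ∀ c : ℝ, 0 < c → ∀ x : En n, Ω (c • x) = Ω x) :
    ∃ M L : ℝ, 0 ≤ M ∧ 0 ≤ L ∧ (∀ x ≠ 0, |Ω x| ≤ M) ∧
      ∀ a : ℝ, 0 < a → ∀ x y : En n, a ≤ ‖x‖ → a ≤ ‖y‖ → |Ω x - Ω y| ≤ L / a * ‖x - y‖ := by
  have hopen : IsOpen {x : En n | x ≠ 0} := isOpen_ne
  have hsph : IsCompact (sphere (0 : En n) 1) := isCompact_sphere _ _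
  have hne : ∀ x ∈ sphere (0 : En n) 1, x ≠ 0 := fun x hx => ne_of_mem_sphere hx one_ne_zero
  have hunit : ∀ x : En n, x ≠ 0 → ‖x‖⁻¹ • x ∈ sphere (0 : En n) 1 := fun x hx => by
    simp [norm_smul, hx]
  have hval : ∀ x : En n, x ≠ 0 → Ω x = Ω (‖x‖⁻¹ • x) := fun x hx =>
    (hΩhom _ (inv_pos.2 (norm_pos_iff.2 hx)) x).symm
  have hloc : LocallyLipschitzOn (sphere (0 : En n) 1) Ω := by
    intro x hx
    have hc : ContDiffAt ℝ 1 Ω x :=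
      ((hΩsmooth x (hne x hx)).contDiffAt (hopen.mem_nhds (hne x hx))).of_le
        (by exact_mod_cast le_top)
    obtain ⟨K, t, ht, hK⟩ := hc.exists_lipschitzOnWith
    exact ⟨K, t, mem_nhdsWithin_of_mem_nhds ht, hK⟩
  obtain ⟨K, hK⟩ := hloc.exists_lipschitzOnWith_of_compact hsph
  obtain ⟨M, hM⟩ := hsph.exists_bound_of_continuousOn hK.continuousOn
  refine ⟨max M 0, 2 * K, le_max_right _ _, by positivity, fun x hx => ?_, fun a ha x y hx hy => ?_⟩
  · rw [hval x hx]
    exact (hM _ (hunit x hx)).trans (le_max_left _ _)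
  · have hx0 : 0 < ‖x‖ := ha.trans_le hx
    have hy0 : 0 < ‖y‖ := ha.trans_le hy
    rw [hval x (norm_pos_iff.1 hx0), hval y (norm_pos_iff.1 hy0)]
    have h1 := hK.dist_le_mul _ (hunit x (norm_pos_iff.1 hx0)) _ (hunit y (norm_pos_iff.1 hy0))
    rw [Real.dist_eq, dist_eq_norm] at h1
    have h2 : ‖‖x‖⁻¹ • x - ‖y‖⁻¹ • y‖ ≤ 2 / a * ‖x - y‖ := by
      have e : ‖x‖⁻¹ • x - ‖y‖⁻¹ • y = ‖x‖⁻¹ • (x - y) + (‖x‖⁻¹ - ‖y‖⁻¹) • y := by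
        rw [smul_sub, sub_smul]; abel
      have e2 : (‖x‖⁻¹ - ‖y‖⁻¹) * ‖y‖ = ‖x‖⁻¹ * (‖y‖ - ‖x‖) := by field_simp
      calc _ ≤ ‖x‖⁻¹ * ‖x - y‖ + ‖x‖⁻¹ * ‖x - y‖ := by
            rw [e]
            refine (norm_add_le _ _).trans ?_
            rw [norm_smul, norm_smul, Real.norm_eq_abs, Real.norm_eq_abs,
              abs_of_pos (inv_pos.2 hx0)]
            have e3 : |‖x‖⁻¹ - ‖y‖⁻¹| * ‖y‖ = ‖x‖⁻¹ * |‖y‖ - ‖x‖| := by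
              rw [← abs_of_pos (inv_pos.2 hx0), ← abs_mul, ← e2, abs_mul, abs_norm,
                abs_of_pos (inv_pos.2 hx0)]
            rw [e3, norm_sub_rev x y]
            gcongr
            exact abs_norm_sub_norm_le _ _
        _ = 2 / ‖x‖ * ‖x - y‖ := by ring
        _ ≤ 2 / a * ‖x - y‖ := by gcongr
    calc _ ≤ K * ‖‖x‖⁻¹ • x - ‖y‖⁻¹ • y‖ := h1
      _ ≤ K * (2 / a * ‖x - y‖) := by gcongr
      _ = _ := by ring

lemma norm_exp_neg_I_mul (x : ℝ) : ‖Complex.exp (-Complex.I * (x : ℂ))‖ = 1 := by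
  rw [neg_mul, mul_comm, ← neg_mul, ← Complex.ofReal_neg]
  exact Complex.norm_exp_ofReal_mul_I _

lemma norm_exp_I_mul (x : ℝ) : ‖Complex.exp (Complex.I * (x : ℂ))‖ = 1 := by
  rw [mul_comm]
  exact Complex.norm_exp_ofReal_mul_I _

lemma continuous_exp_neg_I_inner {n : ℕ} (η : En n) :
    Continuous fun x : En n => Complex.exp (-Complex.I * ((⟪x, η⟫ : ℝ) : ℂ)) := by
  fun_prop

lemma integrable_exp_mul {n : ℕ} {f : En n → ℂ} (hf : Integrable f) (η : En n) :
    Integrable fun x : En n => Complex.exp (-Complex.I * ((⟪x, η⟫ : ℝ) : ℂ)) * f x :=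
  hf.bdd_mul (c := 1) (continuous_exp_neg_I_inner η).aestronglyMeasurable
    (Eventually.of_forall fun _ => (norm_exp_neg_I_mul _).le)

/-- The Fourier transform is controlled by the `L¹` modulus of continuity at half a period. -/
lemma norm_ftP_le_integral_translate {n : ℕ} {f : En n → ℂ} (hf : Integrable f) {η : En n}
    (hη : η ≠ 0) :
    ‖ftP n f η‖ ≤ ∫ x, ‖f x - f (x + (Real.pi / ‖η‖ ^ 2) • η)‖ := by
  set h : En n := (Real.pi / ‖η‖ ^ 2) • η with hh
  have hinner : (⟪h, η⟫ : ℝ) = Real.pi := by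
    rw [hh, real_inner_smul_left, real_inner_self_eq_norm_sq]
    have : ‖η‖ ≠ 0 := norm_ne_zero_iff.2 hη
    field_simp
  have hshift : ∀ x : En n, Complex.exp (-Complex.I * ((⟪x + h, η⟫ : ℝ) : ℂ)) =
      -Complex.exp (-Complex.I * ((⟪x, η⟫ : ℝ) : ℂ)) := fun x => by
    rw [inner_add_left, hinner, Complex.ofReal_add, mul_add, Complex.exp_add]
    have : Complex.exp (-Complex.I * ((Real.pi : ℝ) : ℂ)) = -1 := by
      rw [neg_mul, mul_comm, Complex.exp_neg, Complex.exp_pi_mul_I]; norm_num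
    rw [this]; ring
  have h1 : ftP n f η = ∫ x, -(Complex.exp (-Complex.I * ((⟪x, η⟫ : ℝ) : ℂ)) * f (x + h)) := by
    unfold ftP
    rw [← integral_add_right_eq_self _ h]
    congr 1; ext x
    rw [hshift]; ring
  have hi := integrable_exp_mul hf η
  have hi' := (integrable_exp_mul (hf.comp_add_right h) η)
  have h2 : 2 * ftP n f η =
      ∫ x, Complex.exp (-Complex.I * ((⟪x, η⟫ : ℝ) : ℂ)) * (f x - f (x + h)) := by
    rw [two_mul]
    nth_rewrite 2 [h1]
    unfold ftP
    rw [integral_neg, ← sub_eq_add_neg, ← integral_sub hi hi']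
    congr 1; ext x
    ring
  have h3 : ‖2 * ftP n f η‖ ≤ ∫ x, ‖f x - f (x + h)‖ := by
    rw [h2]
    refine (norm_integral_le_integral_norm _).trans (le_of_eq ?_)
    congr 1; ext x
    rw [norm_mul, norm_exp_neg_I_mul, one_mul]
  rw [norm_mul, Complex.norm_ofNat] at h3
  linarith [norm_nonneg (ftP n f η)]

lemma norm_half_period {n : ℕ} {η : En n} (hη : η ≠ 0) :
    ‖(Real.pi / ‖η‖ ^ 2) • η‖ = Real.pi / ‖η‖ := by
  have : ‖η‖ ≠ 0 := norm_ne_zero_iff.2 hη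
  rw [norm_smul, Real.norm_eq_abs, abs_of_nonneg (by positivity)]
  field_simp

/-- Thin spherical shells have volume comparable to their thickness. -/
lemma exists_volume_shell_le (n : ℕ) (hn : 1 ≤ n) :
    ∃ C : ℝ, 0 ≤ C ∧ ∀ r h : ℝ, 0 ≤ r → r ≤ 1 → 0 ≤ h → h ≤ 1 →
      volume.real {x : En n | |‖x‖ - r| ≤ h} ≤ C * h := by
  refine ⟨2 * (n * 2 ^ (n - 1) * volume.real (closedBall (0 : En n) 1)), by positivity,
    fun r h hr0 hr1 hh0 hh1 => ?_⟩
  set V := volume.real (closedBall (0 : En n) 1) with hV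
  set p := max (r - h) 0 with hp
  have hp0 : 0 ≤ p := le_max_right _ _
  have hfr : Module.finrank ℝ (En n) = n := by simp
  have : Nontrivial (En n) := Module.nontrivial_of_finrank_pos (R := ℝ) (by rw [hfr]; exact hn)
  have hsub : {x : En n | |‖x‖ - r| ≤ h} ⊆ closedBall 0 (r + h) \ ball 0 p := fun x hx => by
    have hx' := abs_le.1 (show |‖x‖ - r| ≤ h from hx)
    simp only [Set.mem_sdiff, mem_closedBall, mem_ball, dist_zero_right, not_lt, hp, max_le_iff]
    exact ⟨by linarith, by linarith, norm_nonneg x⟩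
  have hle : p ≤ r + h := max_le (by linarith) (by linarith)
  calc volume.real {x : En n | |‖x‖ - r| ≤ h}
      ≤ volume.real (closedBall (0 : En n) (r + h) \ ball 0 p) :=
        measureReal_mono hsub (measure_ne_top_of_subset sdiff_subset measure_closedBall_lt_top.ne)
    _ = (r + h) ^ n * V - p ^ n * V := by
        rw [measureReal_sdiff ((ball_subset_closedBall).trans (closedBall_subset_closedBall hle))
          measurableSet_ball measure_closedBall_lt_top.ne, ← Measure.addHaar_real_closedBall_eq_addHaar_real_ball,
          Measure.addHaar_real_closedBall' _ _ (by linarith), Measure.addHaar_real_closedBall' _ _ hp0, hfr]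
    _ = ((r + h) ^ n - p ^ n) * V := by ring
    _ ≤ (2 * h * n * 2 ^ (n - 1)) * V := by
        gcongr
        calc (r + h) ^ n - p ^ n ≤ |(r + h) ^ n - p ^ n| := le_abs_self _
          _ ≤ |r + h - p| * n * max |r + h| |p| ^ (n - 1) := abs_pow_sub_pow_le _ _ _
          _ ≤ 2 * h * n * 2 ^ (n - 1) := by
            rw [abs_of_nonneg (by linarith : 0 ≤ r + h - p), abs_of_nonneg (by linarith : 0 ≤ r + h),
              abs_of_nonneg hp0]
            gcongr
            · have := le_max_left (r - h) 0
              linarith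
            · exact max_le (by linarith) (by linarith)
    _ = _ := by ring

/-- First-order decay of the Fourier transform of a function that is bounded and Lipschitz on the
shell `a < ‖x‖ ≤ 1` and vanishes outside of it; the constant does not depend on `a`. -/
lemma exists_norm_ftP_shell_le (n : ℕ) (hn : 1 ≤ n) :
    ∃ C : ℝ, 0 ≤ C ∧ ∀ (a : ℝ) (F : En n → ℂ) (B L : ℝ), 0 ≤ a → a ≤ 1 → 0 ≤ B → 0 ≤ L →
      (∀ x, a < ‖x‖ → ‖x‖ ≤ 1 → ‖F x‖ ≤ B) →
      (∀ x y, a < ‖x‖ → ‖x‖ ≤ 1 → a < ‖y‖ → ‖y‖ ≤ 1 → ‖F x - F y‖ ≤ L * ‖x - y‖) →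
      Integrable ({x : En n | a < ‖x‖ ∧ ‖x‖ ≤ 1}.indicator F) →
      ∀ η : En n, Real.pi ≤ ‖η‖ →
        ‖ftP n ({x : En n | a < ‖x‖ ∧ ‖x‖ ≤ 1}.indicator F) η‖ ≤ C * (B + L) / ‖η‖ := by
  obtain ⟨C₀, hC₀, hshell⟩ := exists_volume_shell_le n hn
  set V := volume.real (closedBall (0 : En n) 1) with hV
  refine ⟨(V + 2 * C₀) * Real.pi, by positivity, fun a F B L ha0 ha1 hB0 hL0 hB hL hfint η hη => ?_⟩
  have hη0 : η ≠ 0 := norm_pos_iff.1 (Real.pi_pos.trans_le hη)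
  have hηpos : 0 < ‖η‖ := norm_pos_iff.2 hη0
  set A : Set (En n) := {x : En n | a < ‖x‖ ∧ ‖x‖ ≤ 1} with hA
  refine (norm_ftP_le_integral_translate hfint hη0).trans ?_
  set h : En n := (Real.pi / ‖η‖ ^ 2) • η with hh
  have hnorm : ‖h‖ = Real.pi / ‖η‖ := norm_half_period hη0
  have hh1 : ‖h‖ ≤ 1 := by rw [hnorm]; exact (div_le_one hηpos).2 hη
  let Sh : ℝ → Set (En n) := fun r => {x : En n | |‖x‖ - r| ≤ ‖h‖}
  have hShm : ∀ r, MeasurableSet (Sh r) := fun r =>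
    (isClosed_le (by fun_prop) continuous_const).measurableSet
  have hShfin : ∀ r, volume (Sh r) < ∞ := fun r => by
    refine (measure_mono (t := closedBall (0 : En n) (r + ‖h‖)) fun x hx => ?_).trans_lt
      measure_closedBall_lt_top
    have := (abs_le.1 (show |‖x‖ - r| ≤ ‖h‖ from hx)).2
    rw [mem_closedBall, dist_zero_right]; linarith
  let g : En n → ℝ := fun x => (closedBall (0 : En n) 1).indicator (fun _ => L * ‖h‖) x +
    ((Sh a).indicator (fun _ => B) x + (Sh 1).indicator (fun _ => B) x)
  have hi1 : Integrable ((closedBall (0 : En n) 1).indicator fun _ => L * ‖h‖) :=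
    (integrable_indicator_iff measurableSet_closedBall).2
      (integrableOn_const measure_closedBall_lt_top.ne)
  have hi2 : ∀ r, Integrable ((Sh r).indicator fun _ => B) := fun r =>
    (integrable_indicator_iff (hShm r)).2 (integrableOn_const (hShfin r).ne)
  have hdiff : ∀ x, |‖x + h‖ - ‖x‖| ≤ ‖h‖ := fun x => by
    simpa using abs_norm_sub_norm_le (x + h) x
  have hout : ∀ x, (x ∈ A ↔ x + h ∉ A) → x ∈ Sh a ∨ x ∈ Sh 1 := fun x hx => by
    have hd := abs_le.1 (hdiff x)
    by_contra hcon
    simp only [Sh, mem_ofPred_eq, not_or, not_le, lt_abs] at hcon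
    simp only [hA, mem_ofPred_eq] at hx
    rcases hcon with ⟨h1 | h1, h2 | h2⟩
    · have h3 : ¬ (‖x‖ ≤ 1) := by linarith
      have h4 : ¬ (‖x + h‖ ≤ 1) := by linarith
      tauto
    · have h3 : ‖x‖ ≤ 1 := by linarith [norm_nonneg h]
      have h4 : ‖x + h‖ ≤ 1 := by linarith
      have h5 : a < ‖x‖ := by linarith [norm_nonneg h]
      have h6 : a < ‖x + h‖ := by linarith
      tauto
    · linarith [norm_nonneg h]
    · have h5 : ¬ a < ‖x‖ := by linarith [norm_nonneg h]
      have h6 : ¬ a < ‖x + h‖ := by linarith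
      tauto
  have hpt : ∀ x, ‖A.indicator F x - A.indicator F (x + h)‖ ≤ g x := fun x => by
    have n1 : 0 ≤ (closedBall (0 : En n) 1).indicator (fun _ => L * ‖h‖) x :=
      indicator_nonneg (fun _ _ => by positivity) x
    have n2 : ∀ r, 0 ≤ (Sh r).indicator (fun _ => B) x := fun r =>
      indicator_nonneg (fun _ _ => hB0) x
    have key : (x ∈ A ↔ x + h ∉ A) →
        B ≤ (Sh a).indicator (fun _ => B) x + (Sh 1).indicator (fun _ => B) x := fun hx => by
      rcases hout x hx with h1 | h1
      · rw [indicator_of_mem h1]; linarith [n2 1]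
      · rw [indicator_of_mem h1]; linarith [n2 a]
    by_cases hx : x ∈ A <;> by_cases hxh : x + h ∈ A
    · rw [indicator_of_mem hx, indicator_of_mem hxh]
      have h1 := hL x (x + h) hx.1 hx.2 hxh.1 hxh.2
      have h2 : x ∈ closedBall (0 : En n) 1 := by simpa using hx.2
      have h3 : ‖x - (x + h)‖ = ‖h‖ := by simp
      rw [h3] at h1
      simp only [g]
      rw [indicator_of_mem h2]
      linarith [n2 a, n2 1]
    · rw [indicator_of_mem hx, indicator_of_notMem hxh, sub_zero]
      have := hB x hx.1 hx.2
      have := key (by tauto)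
      simp only [g]; linarith
    · rw [indicator_of_mem hxh, indicator_of_notMem hx, zero_sub, norm_neg]
      have := hB _ hxh.1 hxh.2
      have := key (by tauto)
      simp only [g]; linarith
    · rw [indicator_of_notMem hx, indicator_of_notMem hxh, sub_zero, norm_zero]
      simp only [g]; linarith [n2 a, n2 1]
  have hgint : ∫ x, g x = V * (L * ‖h‖) + (volume.real (Sh a) * B + volume.real (Sh 1) * B) := by
    simp only [g]
    have hi3 : Integrable fun x => (Sh a).indicator (fun _ => B) x + (Sh 1).indicator (fun _ => B) x :=
      (hi2 a).add (hi2 1)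
    rw [integral_add hi1 hi3, integral_add (hi2 a) (hi2 1),
      integral_indicator_const _ measurableSet_closedBall, integral_indicator_const _ (hShm a),
      integral_indicator_const _ (hShm 1)]
    simp only [smul_eq_mul, hV]
  calc ∫ x, ‖A.indicator F x - A.indicator F (x + h)‖ ≤ ∫ x, g x :=
        integral_mono_of_nonneg (Eventually.of_forall fun _ => norm_nonneg _)
          (hi1.add ((hi2 a).add (hi2 1))) (Eventually.of_forall hpt)
    _ ≤ V * (L * ‖h‖) + (C₀ * ‖h‖ * B + C₀ * ‖h‖ * B) := by
        rw [hgint]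
        gcongr
        · exact hshell a _ ha0 ha1 (norm_nonneg _) hh1
        · exact hshell 1 _ zero_le_one le_rfl (norm_nonneg _) hh1
    _ ≤ (V + 2 * C₀) * (B + L) * ‖h‖ := by
        have : 0 ≤ V := by positivity
        have h1 : 0 ≤ V * B * ‖h‖ := by positivity
        have h2 : 0 ≤ C₀ * L * ‖h‖ := by positivity
        nlinarith
    _ = _ := by rw [hnorm]; ring

lemma norm_exp_neg_I_sub_one_le (x : ℝ) : ‖Complex.exp (-Complex.I * (x : ℂ)) - 1‖ ≤ |x| := by
  have := Real.norm_exp_I_mul_ofReal_sub_one_le (x := -x)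
  rw [Complex.ofReal_neg, mul_neg, ← neg_mul, norm_neg, Real.norm_eq_abs] at this
  exact this

/-- The Fourier transform of a compactly supported Lipschitz function of mean zero vanishes to first
order at the origin and decays to first order at infinity. -/
lemma exists_norm_ftP_le_of_lipschitz {n : ℕ} {g : En n → ℝ} {K : ℝ≥0} (hg : LipschitzWith K g)
    (hsupp : HasCompactSupport g) (hmean : ∫ x, g x = 0) :
    ∃ A : ℝ, 0 ≤ A ∧ ∀ ζ : En n, ‖ftP n (fun x => (g x : ℂ)) ζ‖ ≤ A * ‖ζ‖ ∧
      ‖ftP n (fun x => (g x : ℂ)) ζ‖ * ‖ζ‖ ≤ A := by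
  have hfint : Integrable g := hg.continuous.integrable_of_hasCompactSupport hsupp
  have hfintC : Integrable fun x => (g x : ℂ) := hfint.ofReal
  obtain ⟨R, hR0, hR⟩ : ∃ R : ℝ, 0 ≤ R ∧ ∀ x, R < ‖x‖ → g x = 0 := by
    obtain ⟨R, hR⟩ := hsupp.isCompact.isBounded.subset_closedBall (0 : En n)
    refine ⟨max R 0, le_max_right _ _, fun x hx => image_eq_zero_of_notMem_tsupport fun h => ?_⟩
    have := hR h
    rw [mem_closedBall, dist_zero_right] at this
    exact absurd hx (not_lt.2 (this.trans (le_max_left _ _)))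
  set I₀ := ∫ x, |g x| with hI
  have hI0 : 0 ≤ I₀ := integral_nonneg fun _ => abs_nonneg _
  set V := volume.real (closedBall (0 : En n) (R + 1)) with hV
  have hV0 : 0 ≤ V := measureReal_nonneg
  have hsmall : ∀ ζ : En n, ‖ftP n (fun x => (g x : ℂ)) ζ‖ ≤ R * I₀ * ‖ζ‖ := fun ζ => by
    have h1 : ftP n (fun x => (g x : ℂ)) ζ =
        ∫ x : En n, (Complex.exp (-Complex.I * ((⟪x, ζ⟫ : ℝ) : ℂ)) - 1) * (g x : ℂ) := by
      have : ∫ x : En n, (g x : ℂ) = 0 := by rw [integral_complex_ofReal, hmean, Complex.ofReal_zero]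
      unfold ftP
      rw [← sub_zero (∫ x : En n, _), ← this, ← integral_sub (integrable_exp_mul hfintC ζ) hfintC]
      congr 1; ext x; ring
    rw [h1]
    have h2 : ∫ x, R * ‖ζ‖ * |g x| = R * I₀ * ‖ζ‖ := by
      rw [integral_const_mul]; ring
    rw [← h2]
    refine norm_integral_le_of_norm_le (hfint.abs.const_mul _) (Eventually.of_forall fun x => ?_)
    rw [norm_mul, Complex.norm_real, Real.norm_eq_abs]
    by_cases hx : R < ‖x‖
    · rw [hR x hx]; simp
    · gcongr
      refine (norm_exp_neg_I_sub_one_le _).trans ((abs_real_inner_le_norm x ζ).trans ?_)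
      gcongr
      exact not_lt.1 hx
  have hlarge : ∀ ζ : En n, Real.pi ≤ ‖ζ‖ →
      ‖ftP n (fun x => (g x : ℂ)) ζ‖ * ‖ζ‖ ≤ K * V * Real.pi := fun ζ hζ => by
    have hζ0 : ζ ≠ 0 := norm_pos_iff.1 (Real.pi_pos.trans_le hζ)
    have hζpos : 0 < ‖ζ‖ := norm_pos_iff.2 hζ0
    have h1 := norm_ftP_le_integral_translate hfintC hζ0
    set h : En n := (Real.pi / ‖ζ‖ ^ 2) • ζ with hh
    have hnorm : ‖h‖ = Real.pi / ‖ζ‖ := norm_half_period hζ0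
    have hh1 : ‖h‖ ≤ 1 := by rw [hnorm]; exact (div_le_one hζpos).2 hζ
    have h2 : ∫ x, ‖(g x : ℂ) - (g (x + h) : ℂ)‖ ≤
        ∫ x, (closedBall (0 : En n) (R + 1)).indicator (fun _ => K * ‖h‖) x := by
      refine integral_mono_of_nonneg (Eventually.of_forall fun _ => norm_nonneg _)
        ((integrable_indicator_iff measurableSet_closedBall).2
          (integrableOn_const measure_closedBall_lt_top.ne)) (Eventually.of_forall fun x => ?_)
      change ‖(g x : ℂ) - (g (x + h) : ℂ)‖ ≤ _
      by_cases hx : x ∈ closedBall (0 : En n) (R + 1)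
      · rw [indicator_of_mem hx, ← Complex.ofReal_sub, Complex.norm_real]
        have := hg.dist_le_mul x (x + h)
        rw [dist_eq_norm, dist_eq_norm] at this
        simpa using this
      · rw [indicator_of_notMem hx]
        rw [mem_closedBall, dist_zero_right, not_le] at hx
        have h3 : ‖x‖ - ‖h‖ ≤ ‖x + h‖ := by simpa using norm_sub_norm_le x (-h)
        rw [hR x (by linarith), hR (x + h) (by linarith)]
        simp
    rw [integral_indicator_const _ measurableSet_closedBall, smul_eq_mul, hnorm] at h2
    calc _ ≤ (V * (K * (Real.pi / ‖ζ‖))) * ‖ζ‖ := by gcongr; exact h1.trans h2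
      _ = _ := by field_simp
  refine ⟨R * I₀ + R * I₀ * Real.pi ^ 2 + K * V * Real.pi, by positivity, fun ζ => ⟨?_, ?_⟩⟩
  · refine (hsmall ζ).trans ?_
    gcongr
    have : 0 ≤ R * I₀ * Real.pi ^ 2 := by positivity
    have : 0 ≤ K * V * Real.pi := by positivity
    linarith
  · have h0 : 0 ≤ R * I₀ := by positivity
    have h0' : 0 ≤ K * V * Real.pi := by positivity
    rcases le_total Real.pi ‖ζ‖ with hζ | hζ
    · have := hlarge ζ hζ
      have : 0 ≤ R * I₀ * Real.pi ^ 2 := by positivity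
      linarith
    · calc _ ≤ R * I₀ * ‖ζ‖ * ‖ζ‖ := by gcongr; exact hsmall ζ
        _ ≤ R * I₀ * Real.pi * Real.pi := by gcongr
        _ ≤ _ := by nlinarith

lemma hasCompactSupport_of_vanishes_outside_cube {n : ℕ} {S : En n → ℝ}
    (hSsupp : ∀ x : En n, (∃ i, 1 < |x i|) → S x = 0) : HasCompactSupport S := by
  refine HasCompactSupport.intro (isCompact_closedBall (0 : En n) (√n)) fun x hx => hSsupp x ?_
  by_contra! hcon
  refine hx ?_
  rw [mem_closedBall, dist_zero_right, EuclideanSpace.norm_eq]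
  gcongr
  calc ∑ i, ‖x i‖ ^ 2 ≤ ∑ _i : Fin n, (1 : ℝ) := by
        gcongr with i
        rw [Real.norm_eq_abs]
        nlinarith [hcon i, abs_nonneg (x i)]
    _ = n := by simp

lemma exists_norm_ftP_DeltaFn_le {n : ℕ} {S : En n → ℝ} (hSsmooth : ContDiff ℝ (⊤ : ℕ∞) S)
    (hSsupp : ∀ x : En n, (∃ i, 1 < |x i|) → S x = 0) :
    ∃ A : ℝ, 0 ≤ A ∧ ∀ ζ : En n, ‖ftP n (fun x => (DeltaFn n S x : ℂ)) ζ‖ ≤ A * ‖ζ‖ ∧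
      ‖ftP n (fun x => (DeltaFn n S x : ℂ)) ζ‖ * ‖ζ‖ ≤ A := by
  have hS := hasCompactSupport_of_vanishes_outside_cube hSsupp
  have hS2 : HasCompactSupport fun x : En n => S ((2 : ℝ) • x) := hS.comp_smul two_ne_zero
  have hS2' : HasCompactSupport fun x : En n => 2 ^ n * S ((2 : ℝ) • x) :=
    hS2.mul_left (f := fun _ => (2 : ℝ) ^ n)
  have hsm2 : ContDiff ℝ (⊤ : ℕ∞) fun x : En n => 2 ^ n * S ((2 : ℝ) • x) :=
    contDiff_const.mul (hSsmooth.comp (contDiff_const_smul 2))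
  have hsupp : HasCompactSupport (DeltaFn n S) := hS2'.sub hS
  have hsm : ContDiff ℝ 1 (DeltaFn n S) := (hsm2.sub hSsmooth).of_le (by exact_mod_cast le_top)
  obtain ⟨K, hK⟩ := hsm.lipschitzWith_of_hasCompactSupport hsupp one_ne_zero
  refine exists_norm_ftP_le_of_lipschitz hK hsupp ?_
  unfold DeltaFn
  rw [integral_sub (hsm2.continuous.integrable_of_hasCompactSupport hS2')
    (hSsmooth.continuous.integrable_of_hasCompactSupport hS), integral_const_mul,
    Measure.integral_comp_smul]
  simp

lemma summable_half_pow_natAbs : Summable fun i : ℤ => (1 / 2 : ℝ) ^ i.natAbs := by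
  refine Summable.of_nat_of_neg ?_ ?_
  · simpa using summable_geometric_two
  · simpa using summable_geometric_two

lemma sq_mul_rpow_le_of_min_bound {A d u σ : ℝ} (hd : 0 ≤ d) (hσ : |σ| ≤ 1 / 2) {i : ℤ}
    (hu1 : (2 : ℝ) ^ i ≤ u) (hu2 : u < (2 : ℝ) ^ (i + 1)) (h1 : d ≤ A * u) (h2 : d * u ≤ A) :
    (d * u ^ σ) ^ 2 ≤ 2 * A ^ 2 * (1 / 2) ^ i.natAbs := by
  have hu : 0 < u := (by positivity : (0 : ℝ) < 2 ^ i).trans_le hu1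
  obtain ⟨hσ1, hσ2⟩ := abs_le.1 hσ
  have hpow : (u ^ σ) ^ 2 = u ^ (2 * σ) := by
    rw [← Real.rpow_natCast, ← Real.rpow_mul hu.le]; congr 1; push_cast; ring
  rw [mul_pow, hpow]
  rcases le_or_gt 0 i with hi | hi
  · have hu1' : 1 ≤ u := (one_le_zpow₀ (by norm_num) hi).trans hu1
    have e : (1 / 2 : ℝ) ^ i.natAbs = ((2 : ℝ) ^ i)⁻¹ := by
      obtain ⟨m, rfl⟩ := Int.eq_ofNat_of_zero_le hi
      simp
    have hd' : d ≤ A / u := (le_div_iff₀ hu).2 h2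
    calc d ^ 2 * u ^ (2 * σ) ≤ (A / u) ^ 2 * u ^ (1 : ℝ) := by
          gcongr
          linarith
      _ = A ^ 2 * u⁻¹ := by rw [Real.rpow_one]; field_simp
      _ ≤ A ^ 2 * ((2 : ℝ) ^ i)⁻¹ := by gcongr
      _ ≤ 2 * A ^ 2 * ((2 : ℝ) ^ i)⁻¹ := by
          have : 0 ≤ A ^ 2 * ((2 : ℝ) ^ i)⁻¹ := by positivity
          linarith
      _ = _ := by rw [e]
  · have hu1' : u ≤ 1 := hu2.le.trans (zpow_le_one_of_nonpos₀ (by norm_num) (by lia))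
    have e : (1 / 2 : ℝ) ^ i.natAbs = (2 : ℝ) ^ i := by
      obtain ⟨m, hm⟩ := Int.eq_ofNat_of_zero_le (by lia : 0 ≤ -i)
      obtain rfl : i = -(m : ℤ) := by lia
      simp
    calc d ^ 2 * u ^ (2 * σ) ≤ (A * u) ^ 2 * u ^ (-1 : ℝ) := by
          gcongr ?_ ^ 2 * ?_
          exact Real.rpow_le_rpow_of_exponent_ge hu hu1' (by linarith)
      _ = A ^ 2 * u := by rw [Real.rpow_neg_one]; field_simp
      _ ≤ A ^ 2 * (2 : ℝ) ^ (i + 1) := by gcongr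
      _ = 2 * A ^ 2 * (2 : ℝ) ^ i := by rw [zpow_add₀ two_ne_zero]; ring
      _ = _ := by rw [e]

/-- Littlewood–Paley type summation: a multiplier of size `‖η‖ ^ σ` is square summable along dyadic
dilations against a bump that vanishes at the origin and at infinity. -/
lemma exists_dyadic_square_sum_le {n : ℕ} {D : En n → ℂ} {A : ℝ}
    (hD : ∀ ζ, ‖D ζ‖ ≤ A * ‖ζ‖ ∧ ‖D ζ‖ * ‖ζ‖ ≤ A) :
    ∃ C : ℝ, 0 ≤ C ∧ ∀ (m : En n → ℂ) (B σ : ℝ) (p q : ℤ), 0 ≤ B → |σ| ≤ 1 / 2 →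
      (∀ η ≠ 0, ‖m η‖ ≤ B * ‖η‖ ^ σ) → ∀ ξ : En n,
      (∑' k : ℤ, (‖D ((2 : ℝ) ^ (-k + q + p) • ξ) * m ((2 : ℝ) ^ (-k + q) • ξ)‖₊ : ℝ≥0∞) ^ (2 : ℝ)) ^
        ((1 : ℝ) / 2) ≤ ENNReal.ofReal (C * (B * (2 : ℝ) ^ (-(p * σ) : ℝ))) := by
  set Z : ℝ := ∑' i : ℤ, (1 / 2 : ℝ) ^ i.natAbs with hZ
  have hZ0 : 0 ≤ Z := tsum_nonneg fun _ => by positivity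
  have hZe : ∑' i : ℤ, ENNReal.ofReal ((1 / 2 : ℝ) ^ i.natAbs) = ENNReal.ofReal Z :=
    (ENNReal.ofReal_tsum_of_nonneg (fun _ => by positivity) summable_half_pow_natAbs).symm
  refine ⟨√(2 * A ^ 2 * Z), by positivity, fun m B σ p q hB hσ hm ξ => ?_⟩
  rcases eq_or_ne ξ 0 with rfl | hξ
  · have h0 : D 0 = 0 := by simpa using (hD 0).1
    simp [h0]
  have hξ0 : 0 < ‖ξ‖ := norm_pos_iff.2 hξ
  obtain ⟨N, hN1, hN2⟩ := exists_mem_Ico_zpow hξ0 (one_lt_two : (1 : ℝ) < 2)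
  set T : ℝ := B * (2 : ℝ) ^ (-(p * σ) : ℝ) with hT
  have hT0 : 0 ≤ T := by positivity
  have hterm : ∀ k : ℤ,
      (‖D ((2 : ℝ) ^ (-k + q + p) • ξ) * m ((2 : ℝ) ^ (-k + q) • ξ)‖₊ : ℝ≥0∞) ^ (2 : ℝ) ≤
      ENNReal.ofReal (T ^ 2 * (2 * A ^ 2)) *
        ENNReal.ofReal ((1 / 2 : ℝ) ^ (N + q + p - k).natAbs) := fun k => by
    set ζ := (2 : ℝ) ^ (-k + q + p) • ξ with hζ
    set η := (2 : ℝ) ^ (-k + q) • ξ with hη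
    have h2pos : ∀ i : ℤ, (0 : ℝ) < 2 ^ i := fun i => by positivity
    have hζn : ‖ζ‖ = (2 : ℝ) ^ (-k + q + p) * ‖ξ‖ := by
      rw [hζ, norm_smul, Real.norm_eq_abs, abs_of_pos (h2pos _)]
    have hηn : ‖η‖ = (2 : ℝ) ^ (-p) * ‖ζ‖ := by
      rw [hη, norm_smul, Real.norm_eq_abs, abs_of_pos (h2pos _), hζn, ← mul_assoc,
        ← zpow_add₀ two_ne_zero]
      congr 2; ring
    have hη0 : η ≠ 0 := smul_ne_zero (h2pos _).ne' hξ
    have hu1 : (2 : ℝ) ^ (N + q + p - k) ≤ ‖ζ‖ := by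
      rw [hζn, show N + q + p - k = (-k + q + p) + N by ring,
        zpow_add₀ two_ne_zero (-k + q + p) N]
      gcongr
    have hu2 : ‖ζ‖ < (2 : ℝ) ^ (N + q + p - k + 1) := by
      rw [hζn, show N + q + p - k + 1 = (-k + q + p) + (N + 1) by ring,
        zpow_add₀ two_ne_zero (-k + q + p) (N + 1)]
      gcongr
    have hmb : ‖m η‖ ≤ T * ‖ζ‖ ^ σ := by
      refine (hm η hη0).trans (le_of_eq ?_)
      rw [hηn, Real.mul_rpow (h2pos _).le (norm_nonneg _), ← Real.rpow_intCast,
        ← Real.rpow_mul two_pos.le, hT]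
      push_cast
      rw [neg_mul]; ring
    have hb : ‖D ζ * m η‖ ^ 2 ≤ T ^ 2 * (2 * A ^ 2) * (1 / 2) ^ (N + q + p - k).natAbs := by
      calc ‖D ζ * m η‖ ^ 2 ≤ (‖D ζ‖ * (T * ‖ζ‖ ^ σ)) ^ 2 := by
            rw [norm_mul]; gcongr
        _ = T ^ 2 * (‖D ζ‖ * ‖ζ‖ ^ σ) ^ 2 := by ring
        _ ≤ T ^ 2 * (2 * A ^ 2 * (1 / 2) ^ (N + q + p - k).natAbs) := by
            gcongr
            exact sq_mul_rpow_le_of_min_bound (norm_nonneg _) hσ hu1 hu2 (hD ζ).1 (hD ζ).2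
        _ = _ := by ring
    rw [← ENNReal.ofReal_mul (by positivity)]
    calc (‖D ζ * m η‖₊ : ℝ≥0∞) ^ (2 : ℝ) = ENNReal.ofReal (‖D ζ * m η‖ ^ 2) := by
          rw [ENNReal.ofReal_pow (norm_nonneg _), ofReal_norm, ← ENNReal.rpow_natCast]
          rfl
      _ ≤ _ := ENNReal.ofReal_le_ofReal hb
  have hreindex : ∑' k : ℤ, ENNReal.ofReal ((1 / 2 : ℝ) ^ (N + q + p - k).natAbs) =
      ENNReal.ofReal Z := by
    rw [← hZe]
    exact (Equiv.subLeft (N + q + p)).tsum_eq fun i : ℤ => ENNReal.ofReal ((1 / 2 : ℝ) ^ i.natAbs)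
  calc _ ≤ (ENNReal.ofReal (T ^ 2 * (2 * A ^ 2)) * ENNReal.ofReal Z) ^ ((1 : ℝ) / 2) := by
        gcongr
        rw [← hreindex, ← ENNReal.tsum_mul_left]
        exact ENNReal.tsum_le_tsum hterm
    _ = ENNReal.ofReal (√(2 * A ^ 2 * Z) * T) := by
        rw [← ENNReal.ofReal_mul (by positivity), ENNReal.ofReal_rpow_of_nonneg (by positivity)
          (by norm_num), ← Real.sqrt_eq_rpow]
        congr 1
        rw [show T ^ 2 * (2 * A ^ 2) * Z = (2 * A ^ 2 * Z) * T ^ 2 by ring,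
          Real.sqrt_mul (by positivity), Real.sqrt_sq hT0]

lemma nontrivial_En {n : ℕ} (hn : 1 ≤ n) : Nontrivial (En n) :=
  Module.nontrivial_of_finrank_pos (R := ℝ) (by rw [finrank_euclideanSpace_fin]; exact hn)

/-- A bound for an integral over `ℝⁿ` from a uniform bound for the integrals along rays. -/
lemma norm_integral_le_of_ray_bound {n : ℕ} (hn : 1 ≤ n) {f : En n → ℂ} (hf : Integrable f) {B : ℝ}
    (hB : ∀ ω : En n, ‖ω‖ = 1 → ‖∫ r in Ioi (0 : ℝ), r ^ (n - 1) • f (r • ω)‖ ≤ B) :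
    ‖∫ x, f x‖ ≤ B * (volume : Measure (En n)).toSphere.real univ := by
  have := nontrivial_En hn
  have hdim : Module.finrank ℝ (En n) = n := finrank_euclideanSpace_fin
  have hmp := (volume : Measure (En n)).measurePreserving_homeomorphUnitSphereProd
  rw [hdim] at hmp
  have hemb := (homeomorphUnitSphereProd (En n)).measurableEmbedding
  let F : sphere (0 : En n) 1 × Ioi (0 : ℝ) → ℂ := fun p => f ((p.2 : ℝ) • (p.1 : En n))
  have hF : F ∘ homeomorphUnitSphereProd (En n) = fun x => f x.1 := by
    ext x
    have hx : ‖x.1‖ ≠ 0 := norm_ne_zero_iff.2 x.2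
    simp [F, smul_smul, hx]
  have h1 : ∫ x, f x = ∫ p, F p ∂((volume : Measure (En n)).toSphere.prod
      (Measure.volumeIoiPow (n - 1))) := by
    rw [← hmp.integral_comp hemb F]
    change _ = ∫ x, (F ∘ homeomorphUnitSphereProd (En n)) x ∂_
    rw [hF, integral_subtype_comap (measurableSet_singleton _).compl f, restrict_compl_singleton]
  have hFint : Integrable F ((volume : Measure (En n)).toSphere.prod
      (Measure.volumeIoiPow (n - 1))) := by
    rw [← hmp.integrable_comp_emb hemb, hF]
    have := integrableOn_iff_comap_subtypeVal (μ := (volume : Measure (En n))) (f := f)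
      (measurableSet_singleton (0 : En n)).compl
    exact this.1 hf.integrableOn
  rw [h1, integral_prod _ hFint]
  refine norm_integral_le_of_norm_le_const (Eventually.of_forall fun ω => ?_)
  refine le_trans (le_of_eq ?_) (hB ω.1 (by simp))
  congr 1
  simp only [Measure.volumeIoiPow, ENNReal.ofReal]
  rw [integral_withDensity_eq_integral_smul,
    integral_subtype_comap measurableSet_Ioi fun a : ℝ =>
      Real.toNNReal (a ^ (n - 1)) • f (a • (ω : En n)),
    setIntegral_congr_fun measurableSet_Ioi fun x hx => ?_]
  · rw [NNReal.smul_def, Real.coe_toNNReal _ (pow_nonneg hx.out.le _)]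
  · exact (measurable_subtype_coe.pow_const _).real_toNNReal

/-- Integrability and mass near the origin of `‖x‖ ^ (α - n)`. -/
lemma exists_integral_norm_rpow_le {n : ℕ} (hn : 1 ≤ n) {α : ℝ} (hα : 0 < α) :
    ∃ C : ℝ, 0 ≤ C ∧ ∀ δ : ℝ, 0 < δ →
      Integrable ((closedBall (0 : En n) δ).indicator fun x => ‖x‖ ^ (α - n)) ∧
      ∫ x, (closedBall (0 : En n) δ).indicator (fun x => ‖x‖ ^ (α - n)) x ≤ C * δ ^ α := by
  have := nontrivial_En hn
  have hdim : Module.finrank ℝ (En n) = n := finrank_euclideanSpace_fin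
  refine ⟨n * (volume.real (ball (0 : En n) 1) * (1 / α)), by positivity, fun δ hδ => ?_⟩
  let f : ℝ → ℝ := (Iic δ).indicator fun y => y ^ (α - n)
  have hfe : ((closedBall (0 : En n) δ).indicator fun x => ‖x‖ ^ (α - n)) = fun x => f ‖x‖ := by
    ext x
    by_cases hx : ‖x‖ ≤ δ <;> simp [f, indicator, hx]
  have hrad : EqOn (fun y : ℝ => y ^ (n - 1) • f y) ((Ioc 0 δ).indicator fun y => y ^ (α - 1))
      (Ioi 0) := fun y hy => by
    have hy0 : 0 < y := hy
    by_cases hyd : y ≤ δ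
    · simp only [f, indicator, mem_Iic, hyd, mem_Ioc, hy0, and_self, if_true, smul_eq_mul]
      rw [← Real.rpow_natCast, ← Real.rpow_add hy0]
      congr 1
      push_cast [Nat.cast_sub hn]; ring
    · simp [f, indicator, hyd]
  have hii : IntervalIntegrable (fun y : ℝ => y ^ (α - 1)) volume 0 δ :=
    intervalIntegral.intervalIntegrable_rpow' (by linarith)
  have hIoc : IntegrableOn (fun y : ℝ => y ^ (α - 1)) (Ioc 0 δ) :=
    (intervalIntegrable_iff_integrableOn_Ioc_of_le hδ.le).1 hii
  rw [hfe]
  constructor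
  · rw [integrable_fun_norm_addHaar, hdim, integrableOn_congr_fun hrad measurableSet_Ioi]
    exact ((integrable_indicator_iff measurableSet_Ioc).2 hIoc).integrableOn
  · rw [integral_fun_norm_addHaar, hdim, setIntegral_congr_fun measurableSet_Ioi hrad,
      setIntegral_indicator measurableSet_Ioc, inter_eq_right.2 Ioc_subset_Ioi_self,
      ← intervalIntegral.integral_of_le hδ.le, integral_rpow (Or.inl (by linarith))]
    simp only [sub_add_cancel, Real.zero_rpow hα.ne', sub_zero, smul_eq_mul, nsmul_eq_mul]
    refine le_of_eq ?_
    ring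

/-- The oscillating kernel `(e ^ {i lam |t| ^ α} - ε) K(t)`. -/
def oscKernel (n : ℕ) (α : ℝ) (Ω : En n → ℝ) (lam : ℝ) (ε : ℂ) (t : En n) : ℂ :=
  (Complex.exp (Complex.I * ((lam * ‖t‖ ^ α : ℝ) : ℂ)) - ε) * (czKernel n Ω t : ℂ)

lemma aestronglyMeasurable_oscKernel {n : ℕ} (hn : 1 ≤ n) {α : ℝ} (hα : 0 < α) {Ω : En n → ℝ}
    (hΩ : ContinuousOn Ω {x : En n | x ≠ 0}) (lam : ℝ) (ε : ℂ) :
    AEStronglyMeasurable (oscKernel n α Ω lam ε) volume := by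
  have := nontrivial_En hn
  have hK : ContinuousOn (czKernel n Ω) {x : En n | x ≠ 0} :=
    hΩ.div (by fun_prop) fun x hx => pow_ne_zero _ (norm_ne_zero_iff.2 hx)
  have hcont : ContinuousOn (oscKernel n α Ω lam ε) {x : En n | x ≠ 0} := by
    refine ContinuousOn.mul ?_ (Complex.continuous_ofReal.comp_continuousOn hK)
    have : Continuous fun t : En n => ‖t‖ ^ α := continuous_norm.rpow_const fun _ => Or.inr hα.le
    exact Continuous.continuousOn (by fun_prop)
  have := hcont.aestronglyMeasurable (μ := volume) isOpen_ne.measurableSet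
  rwa [show {x : En n | x ≠ 0} = ({0} : Set (En n))ᶜ from rfl, restrict_compl_singleton] at this

lemma norm_exp_I_mul_sub_le {ε : ℂ} (hε : ‖ε‖ ≤ 1) (x : ℝ) :
    ‖Complex.exp (Complex.I * (x : ℂ)) - ε‖ ≤ 2 := by
  refine (norm_sub_le _ _).trans ?_
  rw [norm_exp_I_mul]
  linarith

/-- Lipschitz bound for the radial profile of the oscillating kernel. -/
lemma norm_radialProfile_sub_le (n : ℕ) {α lam a : ℝ} (hα : 0 < α) (hlam : 0 ≤ lam) {ε : ℂ}
    (hε : ‖ε‖ ≤ 1) (ha : 0 < a) {r s : ℝ} (hr : r ∈ Icc a 1) (hs : s ∈ Icc a 1) :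
    ‖(Complex.exp (Complex.I * ((lam * r ^ α : ℝ) : ℂ)) - ε) * (((r ^ n)⁻¹ : ℝ) : ℂ) -
      (Complex.exp (Complex.I * ((lam * s ^ α : ℝ) : ℂ)) - ε) * (((s ^ n)⁻¹ : ℝ) : ℂ)‖ ≤
      (lam * α + 2 * n) * (a ^ (n + 1))⁻¹ * |r - s| := by
  have hder : ∀ x ∈ Icc a 1, HasDerivWithinAt
      (fun r : ℝ => (Complex.exp (Complex.I * ((lam * r ^ α : ℝ) : ℂ)) - ε) * (((r ^ n)⁻¹ : ℝ) : ℂ))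
      (Complex.exp (Complex.I * ((lam * x ^ α : ℝ) : ℂ)) *
          (Complex.I * ((lam * (α * x ^ (α - 1)) : ℝ) : ℂ)) * (((x ^ n)⁻¹ : ℝ) : ℂ) +
        (Complex.exp (Complex.I * ((lam * x ^ α : ℝ) : ℂ)) - ε) *
          ((-(n * x ^ (n - 1)) / (x ^ n) ^ 2 : ℝ) : ℂ)) (Icc a 1) x := fun x hx => by
    have hx0 : 0 < x := ha.trans_le hx.1
    have h1 : HasDerivAt (fun r : ℝ => lam * r ^ α) (lam * (α * x ^ (α - 1))) x :=
      (Real.hasDerivAt_rpow_const (Or.inl hx0.ne')).const_mul lam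
    have h2 : HasDerivAt (fun r : ℝ => (r ^ n)⁻¹) (-(n * x ^ (n - 1)) / (x ^ n) ^ 2) x :=
      (hasDerivAt_pow n x).fun_inv (pow_ne_zero _ hx0.ne')
    exact (((h1.ofReal_comp.const_mul Complex.I).cexp.sub_const ε).mul h2.ofReal_comp).hasDerivWithinAt
  have hbd : ∀ x ∈ Icc a 1, ‖Complex.exp (Complex.I * ((lam * x ^ α : ℝ) : ℂ)) *
          (Complex.I * ((lam * (α * x ^ (α - 1)) : ℝ) : ℂ)) * (((x ^ n)⁻¹ : ℝ) : ℂ) +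
        (Complex.exp (Complex.I * ((lam * x ^ α : ℝ) : ℂ)) - ε) *
          ((-(n * x ^ (n - 1)) / (x ^ n) ^ 2 : ℝ) : ℂ)‖ ≤
        (lam * α + 2 * n) * (a ^ (n + 1))⁻¹ := fun x hx => by
    have hx0 : 0 < x := ha.trans_le hx.1
    have hpow : (x ^ (n + 1))⁻¹ ≤ (a ^ (n + 1))⁻¹ := by
      have := hx.1
      gcongr
    have h1 : x ^ (α - 1) * (x ^ n)⁻¹ ≤ (x ^ (n + 1))⁻¹ := by
      have : x ^ (α - 1) ≤ x ^ (-1 : ℝ) :=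
        Real.rpow_le_rpow_of_exponent_ge hx0 hx.2 (by linarith)
      rw [Real.rpow_neg_one] at this
      calc x ^ (α - 1) * (x ^ n)⁻¹ ≤ x⁻¹ * (x ^ n)⁻¹ := by gcongr
        _ = (x ^ (n + 1))⁻¹ := by rw [pow_succ', mul_inv]
    have h2 : n * x ^ (n - 1) / (x ^ n) ^ 2 = n * (x ^ (n + 1))⁻¹ := by
      rcases n with _ | m
      · simp
      · simp only [Nat.add_sub_cancel]
        field_simp
        ring
    refine (norm_add_le _ _).trans ?_
    rw [norm_mul, norm_mul, norm_mul, norm_mul, norm_exp_I_mul, Complex.norm_I, Complex.norm_real,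
      Complex.norm_real, Complex.norm_real, Real.norm_eq_abs, Real.norm_eq_abs, Real.norm_eq_abs,
      neg_div, abs_neg, abs_of_nonneg (by positivity), abs_of_nonneg (by positivity),
      abs_of_nonneg (by positivity), h2]
    calc 1 * (1 * (lam * (α * x ^ (α - 1)))) * (x ^ n)⁻¹ +
          ‖Complex.exp (Complex.I * ((lam * x ^ α : ℝ) : ℂ)) - ε‖ * (n * (x ^ (n + 1))⁻¹)
        = lam * α * (x ^ (α - 1) * (x ^ n)⁻¹) +
          ‖Complex.exp (Complex.I * ((lam * x ^ α : ℝ) : ℂ)) - ε‖ * (n * (x ^ (n + 1))⁻¹) := by ring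
      _ ≤ lam * α * (a ^ (n + 1))⁻¹ + 2 * (n * (a ^ (n + 1))⁻¹) := by
        gcongr
        · exact h1.trans hpow
        · exact norm_exp_I_mul_sub_le hε _
      _ = _ := by ring
  exact (convex_Icc a 1).norm_image_sub_le_of_norm_hasDerivWithin_le hder hbd hs hr

lemma oscKernel_eq (n : ℕ) (α : ℝ) (Ω : En n → ℝ) (lam : ℝ) (ε : ℂ) (t : En n) :
    oscKernel n α Ω lam ε t = (Complex.exp (Complex.I * ((lam * ‖t‖ ^ α : ℝ) : ℂ)) - ε) *
      (((‖t‖ ^ n)⁻¹ : ℝ) : ℂ) * (Ω t : ℂ) := by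
  rw [oscKernel, czKernel, div_eq_mul_inv, mul_comm (Ω t), Complex.ofReal_mul (_ ⁻¹), mul_assoc]

lemma norm_radialProfile_le (n : ℕ) (α lam : ℝ) {a : ℝ} {ε : ℂ}
    (hε : ‖ε‖ ≤ 1) (ha : 0 < a) {r : ℝ} (hr : a ≤ r) :
    ‖(Complex.exp (Complex.I * ((lam * r ^ α : ℝ) : ℂ)) - ε) * (((r ^ n)⁻¹ : ℝ) : ℂ)‖ ≤
      2 * (a ^ n)⁻¹ := by
  have hr0 : 0 < r := ha.trans_le hr
  rw [norm_mul, Complex.norm_real, Real.norm_eq_abs, abs_of_pos (by positivity)]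
  gcongr
  exact norm_exp_I_mul_sub_le hε _

lemma norm_oscKernel_le {n : ℕ} (α : ℝ) {Ω : En n → ℝ} {M : ℝ} (hM : ∀ x ≠ 0, |Ω x| ≤ M)
    (lam : ℝ) {a : ℝ} {ε : ℂ} (hε : ‖ε‖ ≤ 1) (ha : 0 < a) {x : En n} (hx : a ≤ ‖x‖) :
    ‖oscKernel n α Ω lam ε x‖ ≤ 2 * (a ^ n)⁻¹ * M := by
  rw [oscKernel_eq, norm_mul, Complex.norm_real, Real.norm_eq_abs]
  gcongr
  · exact norm_radialProfile_le n α lam hε ha hx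
  · exact hM x (norm_pos_iff.1 (ha.trans_le hx))

lemma norm_oscKernel_sub_le {n : ℕ} {α : ℝ} (hα : 0 < α) {Ω : En n → ℝ} {M L : ℝ}
    (hM : ∀ x ≠ 0, |Ω x| ≤ M)
    (hL : ∀ a : ℝ, 0 < a → ∀ x y : En n, a ≤ ‖x‖ → a ≤ ‖y‖ → |Ω x - Ω y| ≤ L / a * ‖x - y‖)
    {lam : ℝ} (hlam : 0 ≤ lam) {a : ℝ} {ε : ℂ} (hε : ‖ε‖ ≤ 1) (ha : 0 < a) {x y : En n}
    (hx : a ≤ ‖x‖) (hx1 : ‖x‖ ≤ 1) (hy : a ≤ ‖y‖) (hy1 : ‖y‖ ≤ 1) :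
    ‖oscKernel n α Ω lam ε x - oscKernel n α Ω lam ε y‖ ≤
      ((lam * α + 2 * n) * M + 2 * L) * (a ^ (n + 1))⁻¹ * ‖x - y‖ := by
  have hM0 : 0 ≤ M := (abs_nonneg _).trans (hM x (norm_pos_iff.1 (ha.trans_le hx)))
  have h1 := norm_radialProfile_sub_le n hα hlam hε ha ⟨hx, hx1⟩ ⟨hy, hy1⟩
  have h2 := norm_radialProfile_le n α lam hε ha hy
  rw [oscKernel_eq, oscKernel_eq]
  set P := (Complex.exp (Complex.I * ((lam * ‖x‖ ^ α : ℝ) : ℂ)) - ε) * (((‖x‖ ^ n)⁻¹ : ℝ) : ℂ)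
  set Q := (Complex.exp (Complex.I * ((lam * ‖y‖ ^ α : ℝ) : ℂ)) - ε) * (((‖y‖ ^ n)⁻¹ : ℝ) : ℂ)
  calc ‖P * (Ω x : ℂ) - Q * (Ω y : ℂ)‖ = ‖(P - Q) * (Ω x : ℂ) + Q * ((Ω x - Ω y : ℝ) : ℂ)‖ := by
        push_cast; congr 1; ring
    _ ≤ ‖P - Q‖ * |Ω x| + ‖Q‖ * |Ω x - Ω y| := by
        refine (norm_add_le _ _).trans (le_of_eq ?_)
        rw [norm_mul, norm_mul, Complex.norm_real, Complex.norm_real, Real.norm_eq_abs,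
          Real.norm_eq_abs]
    _ ≤ (lam * α + 2 * n) * (a ^ (n + 1))⁻¹ * ‖x - y‖ * M +
        2 * (a ^ n)⁻¹ * (L / a * ‖x - y‖) := by
        gcongr
        · exact h1.trans (by gcongr; exact abs_norm_sub_norm_le x y)
        · exact hM x (norm_pos_iff.1 (ha.trans_le hx))
        · exact hL a ha x y hx hy
    _ = _ := by
        rw [pow_succ, mul_inv, div_eq_mul_inv]; ring

lemma measurableSet_shell (n : ℕ) (a : ℝ) : MeasurableSet {x : En n | a < ‖x‖ ∧ ‖x‖ ≤ 1} :=
  (measurableSet_lt measurable_const measurable_norm).inter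
    (measurableSet_le measurable_norm measurable_const)

lemma measure_shell_lt_top (n : ℕ) (a : ℝ) : volume {x : En n | a < ‖x‖ ∧ ‖x‖ ≤ 1} < ∞ :=
  (measure_mono fun x hx => by simpa using hx.2).trans_lt
    (measure_closedBall_lt_top (x := (0 : En n)) (r := 1))

lemma integrable_indicator_shell_oscKernel {n : ℕ} (hn : 1 ≤ n) {α : ℝ} (hα : 0 < α)
    {Ω : En n → ℝ} (hΩ : ContinuousOn Ω {x : En n | x ≠ 0}) {M : ℝ} (hM : ∀ x ≠ 0, |Ω x| ≤ M)
    (lam : ℝ) {a : ℝ} {ε : ℂ} (hε : ‖ε‖ ≤ 1) (ha : 0 < a) :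
    Integrable ({x : En n | a < ‖x‖ ∧ ‖x‖ ≤ 1}.indicator (oscKernel n α Ω lam ε)) := by
  rw [integrable_indicator_iff (measurableSet_shell n a)]
  refine Measure.integrableOn_of_bounded (M := 2 * (a ^ n)⁻¹ * M) (measure_shell_lt_top n a).ne
    (aestronglyMeasurable_oscKernel hn hα hΩ lam ε) ?_
  filter_upwards [ae_restrict_mem (measurableSet_shell n a)] with x hx
  exact norm_oscKernel_le α hM lam hε ha hx.1.le

/-- Decay at infinity of the Fourier transform of the oscillating kernel on a shell. -/
lemma exists_norm_ftP_shell_oscKernel_le {n : ℕ} (hn : 1 ≤ n) {α : ℝ} (hα : 0 < α) {Ω : En n → ℝ}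
    (hΩ : ContinuousOn Ω {x : En n | x ≠ 0}) {M L : ℝ} (hM0 : 0 ≤ M) (hL0 : 0 ≤ L)
    (hM : ∀ x ≠ 0, |Ω x| ≤ M)
    (hL : ∀ a : ℝ, 0 < a → ∀ x y : En n, a ≤ ‖x‖ → a ≤ ‖y‖ → |Ω x - Ω y| ≤ L / a * ‖x - y‖) :
    ∃ C : ℝ, 0 ≤ C ∧ ∀ (lam a : ℝ) (ε : ℂ), 1 ≤ lam → 0 < a → a ≤ 1 → ‖ε‖ ≤ 1 →
      ∀ η : En n, Real.pi ≤ ‖η‖ →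
        ‖ftP n ({x : En n | a < ‖x‖ ∧ ‖x‖ ≤ 1}.indicator (oscKernel n α Ω lam ε)) η‖ ≤
          C * lam * (a ^ (n + 1))⁻¹ / ‖η‖ := by
  obtain ⟨C, hC, hshell⟩ := exists_norm_ftP_shell_le n hn
  refine ⟨C * (2 * M + ((α + 2 * n) * M + 2 * L)), by positivity,
    fun lam a ε hlam ha ha1 hε η hη => ?_⟩
  have hlam0 : 0 ≤ lam := zero_le_one.trans hlam
  refine (hshell a (oscKernel n α Ω lam ε) (2 * (a ^ n)⁻¹ * M)
    (((lam * α + 2 * n) * M + 2 * L) * (a ^ (n + 1))⁻¹) ha.le ha1 (by positivity) (by positivity)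
    (fun x hx _ => norm_oscKernel_le α hM lam hε ha hx.le)
    (fun x y hx hx1 hy hy1 => norm_oscKernel_sub_le hα hM hL hlam0 hε ha hx.le hx1 hy.le hy1)
    (integrable_indicator_shell_oscKernel hn hα hΩ hM lam hε ha) η hη).trans ?_
  have hpow : (a ^ n)⁻¹ ≤ (a ^ (n + 1))⁻¹ := by
    gcongr 1
    exact pow_le_pow_of_le_one ha.le ha1 n.le_succ
  have hB : 2 * (a ^ n)⁻¹ * M ≤ 2 * M * lam * (a ^ (n + 1))⁻¹ :=
    calc 2 * (a ^ n)⁻¹ * M ≤ 2 * (a ^ (n + 1))⁻¹ * M := by gcongr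
      _ ≤ 2 * (a ^ (n + 1))⁻¹ * M * lam := le_mul_of_one_le_right (by positivity) hlam
      _ = _ := by ring
  have hcoef : (lam * α + 2 * n) * M + 2 * L ≤ ((α + 2 * n) * M + 2 * L) * lam := by
    have : 0 ≤ (lam - 1) * (2 * n * M + 2 * L) :=
      mul_nonneg (sub_nonneg.2 hlam) (by positivity)
    linarith
  calc C * (2 * (a ^ n)⁻¹ * M + ((lam * α + 2 * n) * M + 2 * L) * (a ^ (n + 1))⁻¹) / ‖η‖
      ≤ C * (2 * M * lam * (a ^ (n + 1))⁻¹ +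
        ((α + 2 * n) * M + 2 * L) * lam * (a ^ (n + 1))⁻¹) / ‖η‖ := by gcongr
    _ = _ := by ring

/-- Decay in the size of the phase, uniformly in the frequency. -/
lemma exists_norm_ftP_shell_oscKernel_le_sqrt {n : ℕ} (hn : 1 ≤ n) {α : ℝ} (hα : 0 < α)
    (hα1 : α ≠ 1) {Ω : En n → ℝ} (hΩ : ContinuousOn Ω {x : En n | x ≠ 0})
    (hΩhom : ∀ c : ℝ, 0 < c → ∀ x : En n, Ω (c • x) = Ω x) {M : ℝ} (hM0 : 0 ≤ M)
    (hM : ∀ x ≠ 0, |Ω x| ≤ M) :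
    ∃ C : ℝ, 0 ≤ C ∧ ∀ lam : ℝ, 0 < lam → ∀ ξ : En n,
      ‖ftP n ({x : En n | 1 / 2 < ‖x‖ ∧ ‖x‖ ≤ 1}.indicator (oscKernel n α Ω lam 0)) ξ‖ ≤
        C / √lam := by
  obtain ⟨C, hC, hrad⟩ := exists_radial_oscillatory_bound α hα hα1
  refine ⟨M * C * (volume : Measure (En n)).toSphere.real univ, by positivity,
    fun lam hlam ξ => ?_⟩
  have hfint := integrable_exp_mul (integrable_indicator_shell_oscKernel hn hα hΩ hM lam
    (ε := 0) (by simp) one_half_pos) ξ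
  refine (norm_integral_le_of_ray_bound hn hfint (B := M * (C / √lam)) fun ω hω => ?_).trans
    (le_of_eq (by ring))
  have hω0 : ω ≠ 0 := norm_ne_zero_iff.1 (by rw [hω]; exact one_ne_zero)
  have heq : EqOn (fun r : ℝ => r ^ (n - 1) •
      (Complex.exp (-Complex.I * ((⟪r • ω, ξ⟫ : ℝ) : ℂ)) *
        {x : En n | 1 / 2 < ‖x‖ ∧ ‖x‖ ≤ 1}.indicator (oscKernel n α Ω lam 0) (r • ω)))
      ((Ioc (1 / 2 : ℝ) 1).indicator fun r => (Ω ω : ℂ) *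
        (Complex.exp (Complex.I * ((lam * r ^ α - ⟪ω, ξ⟫ * r : ℝ) : ℂ)) * ((r⁻¹ : ℝ) : ℂ)))
      (Ioi 0) := fun r hr => by
    have hr0 : 0 < r := hr
    have hnorm : ‖r • ω‖ = r := by rw [norm_smul, hω, mul_one, Real.norm_of_nonneg hr0.le]
    by_cases hmem : r ∈ Ioc (1 / 2 : ℝ) 1
    · have hmem' : r • ω ∈ {x : En n | 1 / 2 < ‖x‖ ∧ ‖x‖ ≤ 1} := by
        change 1 / 2 < ‖r • ω‖ ∧ ‖r • ω‖ ≤ 1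
        rwa [hnorm]
      have hexp : Complex.exp (Complex.I * ((lam * r ^ α - ⟪ω, ξ⟫ * r : ℝ) : ℂ)) =
          Complex.exp (-Complex.I * ((r * ⟪ω, ξ⟫ : ℝ) : ℂ)) *
            Complex.exp (Complex.I * ((lam * r ^ α : ℝ) : ℂ)) := by
        rw [← Complex.exp_add]
        push_cast
        congr 1
        ring
      have hpow : (r : ℂ) ^ (n - 1) * ((r : ℂ) ^ n)⁻¹ = (r : ℂ)⁻¹ := by
        have hrc : (r : ℂ) ≠ 0 := Complex.ofReal_ne_zero.2 hr0.ne'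
        obtain ⟨k, rfl⟩ := Nat.exists_eq_add_of_le' hn
        rw [Nat.add_sub_cancel, pow_succ]
        field_simp
      simp only [indicator_of_mem hmem', indicator_of_mem hmem]
      rw [oscKernel_eq, hnorm, hΩhom r hr0, real_inner_smul_left, hexp, sub_zero, Complex.real_smul,
        Complex.ofReal_pow, Complex.ofReal_inv, Complex.ofReal_inv, Complex.ofReal_pow, ← hpow]
      ring
    · have hmem' : r • ω ∉ {x : En n | 1 / 2 < ‖x‖ ∧ ‖x‖ ≤ 1} := by
        change ¬(1 / 2 < ‖r • ω‖ ∧ ‖r • ω‖ ≤ 1)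
        rwa [hnorm]
      simp only [indicator_of_notMem hmem', indicator_of_notMem hmem, mul_zero, smul_zero]
  have hsub : Ioc (1 / 2 : ℝ) 1 ⊆ Ioi 0 := fun r hr => one_half_pos.trans hr.1
  rw [setIntegral_congr_fun measurableSet_Ioi heq, setIntegral_indicator measurableSet_Ioc,
    inter_eq_self_of_subset_right hsub,
    ← intervalIntegral.integral_of_le (by norm_num), intervalIntegral.integral_const_mul, norm_mul,
    Complex.norm_real, Real.norm_eq_abs]
  gcongr
  · exact hM ω hω0
  · exact hrad lam hlam _

lemma norm_ftP_le_integral_norm {n : ℕ} (f : En n → ℂ) (ξ : En n) :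
    ‖ftP n f ξ‖ ≤ ∫ x, ‖f x‖ := by
  refine (norm_integral_le_integral_norm _).trans (le_of_eq ?_)
  simp only [norm_mul, norm_exp_neg_I_mul, one_mul]

lemma norm_ftP_sub_ftP_zero_le {n : ℕ} {f : En n → ℂ} (hf : Integrable f)
    (hsupp : ∀ x, 1 < ‖x‖ → f x = 0) (ξ : En n) :
    ‖ftP n f ξ - ftP n f 0‖ ≤ (∫ x, ‖f x‖) * ‖ξ‖ := by
  rw [ftP, ftP, ← integral_sub (integrable_exp_mul hf ξ) (integrable_exp_mul hf 0),
    ← integral_mul_const]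
  refine norm_integral_le_of_norm_le (hf.norm.mul_const _) (Eventually.of_forall fun x => ?_)
  rw [inner_zero_right, Complex.ofReal_zero, mul_zero, Complex.exp_zero, ← sub_mul, norm_mul,
    mul_comm]
  rcases le_or_gt ‖x‖ 1 with hx | hx
  · gcongr
    exact (norm_exp_neg_I_sub_one_le _).trans <| (abs_real_inner_le_norm x ξ).trans
      (mul_le_of_le_one_left (norm_nonneg _) hx)
  · simp [hsupp x hx]

lemma ftP_indicator {n : ℕ} {s : Set (En n)} (hs : MeasurableSet s) (g : En n → ℂ) (ξ : En n) :
    ftP n (s.indicator g) ξ =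
      ∫ t in s, Complex.exp (-Complex.I * ((⟪t, ξ⟫ : ℝ) : ℂ)) * g t := by
  rw [← integral_indicator hs, ftP]
  congr 1
  ext t
  by_cases ht : t ∈ s <;> simp [ht]

lemma ftP_indicator_sub_ftP_zero {n : ℕ} {s : Set (En n)} (hs : MeasurableSet s) {g : En n → ℂ}
    (hg : Integrable (s.indicator g)) (ξ : En n) :
    ftP n (s.indicator g) ξ - ftP n (s.indicator g) 0 =
      ∫ t in s, (Complex.exp (-Complex.I * ((⟪t, ξ⟫ : ℝ) : ℂ)) - 1) * g t := by
  rw [ftP, ftP, ← integral_sub (integrable_exp_mul hg ξ) (integrable_exp_mul hg 0),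
    ← integral_indicator hs]
  congr 1
  ext t
  by_cases ht : t ∈ s <;> simp [ht, sub_mul]

lemma measurableSet_unitBall (n : ℕ) : MeasurableSet {t : En n | ‖t‖ ≤ 1} :=
  measurableSet_le measurable_norm measurable_const

lemma oscKernel_dyadic (n : ℕ) (α : ℝ) (Ω : En n → ℝ) (ℓ : ℕ) (t : En n) :
    oscKernel n α Ω (((2 : ℝ) ^ ℓ) ^ α) 0 t =
      Complex.exp (Complex.I * ((((2 : ℝ) ^ ℓ * ‖t‖) ^ α : ℝ) : ℂ)) * (czKernel n Ω t : ℂ) := by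
  rw [oscKernel, sub_zero, Real.mul_rpow (by positivity) (norm_nonneg t)]

lemma oscKernel_one_one (n : ℕ) (α : ℝ) (Ω : En n → ℝ) (t : En n) :
    oscKernel n α Ω 1 1 t =
      (Complex.exp (Complex.I * ((‖t‖ ^ α : ℝ) : ℂ)) - 1) * (czKernel n Ω t : ℂ) := by
  rw [oscKernel, one_mul]

lemma mMul_zero_eq_ftP (n : ℕ) (α : ℝ) (Ω : En n → ℝ) (ξ : En n) :
    mMul n α Ω 0 ξ = ftP n ({t : En n | ‖t‖ ≤ 1}.indicator (oscKernel n α Ω 1 1)) ξ := by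
  rw [ftP_indicator (measurableSet_unitBall n), mMul, if_pos rfl]
  refine integral_congr_ae (Eventually.of_forall fun t => ?_)
  simp only [oscKernel_one_one]
  ring

lemma mMul_eq_ftP (n : ℕ) (α : ℝ) (Ω : En n → ℝ) {ℓ : ℕ} (hℓ : ℓ ≠ 0) (ξ : En n) :
    mMul n α Ω ℓ ξ = ftP n ({t : En n | 1 / 2 < ‖t‖ ∧ ‖t‖ ≤ 1}.indicator
      (oscKernel n α Ω (((2 : ℝ) ^ ℓ) ^ α) 0)) ξ := by
  rw [ftP_indicator (measurableSet_shell n _), mMul, if_neg hℓ]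
  refine integral_congr_ae (Eventually.of_forall fun t => ?_)
  simp only [oscKernel_dyadic]
  ring

lemma mMulTilde_zero_eq_ftP {n : ℕ} {α : ℝ} {Ω : En n → ℝ}
    (hf : Integrable ({t : En n | ‖t‖ ≤ 1}.indicator (oscKernel n α Ω 1 1))) (ξ : En n) :
    mMulTilde n α Ω 0 ξ = ftP n ({t : En n | ‖t‖ ≤ 1}.indicator (oscKernel n α Ω 1 1)) ξ -
      ftP n ({t : En n | ‖t‖ ≤ 1}.indicator (oscKernel n α Ω 1 1)) 0 := by
  rw [ftP_indicator_sub_ftP_zero (measurableSet_unitBall n) hf, mMulTilde, if_pos rfl]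
  refine integral_congr_ae (Eventually.of_forall fun t => ?_)
  simp only [oscKernel_one_one]
  ring

lemma mMulTilde_eq_ftP {n : ℕ} {α : ℝ} {Ω : En n → ℝ} {ℓ : ℕ} (hℓ : ℓ ≠ 0)
    (hf : Integrable ({t : En n | 1 / 2 < ‖t‖ ∧ ‖t‖ ≤ 1}.indicator
      (oscKernel n α Ω (((2 : ℝ) ^ ℓ) ^ α) 0))) (ξ : En n) :
    mMulTilde n α Ω ℓ ξ = ftP n ({t : En n | 1 / 2 < ‖t‖ ∧ ‖t‖ ≤ 1}.indicator
        (oscKernel n α Ω (((2 : ℝ) ^ ℓ) ^ α) 0)) ξ -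
      ftP n ({t : En n | 1 / 2 < ‖t‖ ∧ ‖t‖ ≤ 1}.indicator
        (oscKernel n α Ω (((2 : ℝ) ^ ℓ) ^ α) 0)) 0 := by
  rw [ftP_indicator_sub_ftP_zero (measurableSet_shell n _) hf, mMulTilde, if_neg hℓ]
  refine integral_congr_ae (Eventually.of_forall fun t => ?_)
  simp only [oscKernel_dyadic]
  ring

lemma norm_oscKernel_one_one_le {n : ℕ} (hn : 1 ≤ n) (α : ℝ) {Ω : En n → ℝ} {M : ℝ} (hM0 : 0 ≤ M)
    (hM : ∀ x ≠ 0, |Ω x| ≤ M) (t : En n) :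
    ‖oscKernel n α Ω 1 1 t‖ ≤ M * ‖t‖ ^ (α - n) := by
  rcases eq_or_ne t 0 with rfl | ht
  · have h0 : czKernel n Ω 0 = 0 := by simp [czKernel, Nat.one_le_iff_ne_zero.1 hn]
    rw [oscKernel_one_one, h0, Complex.ofReal_zero, mul_zero, norm_zero]
    positivity
  · have ht0 : 0 < ‖t‖ := norm_pos_iff.2 ht
    have h1 : ‖Complex.exp (Complex.I * ((‖t‖ ^ α : ℝ) : ℂ)) - 1‖ ≤ ‖t‖ ^ α :=
      Real.norm_exp_I_mul_ofReal_sub_one_le.trans_eq (Real.norm_of_nonneg (by positivity))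
    rw [oscKernel_one_one, czKernel, norm_mul, Complex.norm_real, norm_div, norm_pow, norm_norm,
      Real.norm_eq_abs, Real.rpow_sub ht0, Real.rpow_natCast]
    calc _ ≤ ‖t‖ ^ α * (M / ‖t‖ ^ n) := by
          gcongr
          exact hM t ht
      _ = _ := by ring

/-- Boundedness and power decay of the Fourier transform of the kernel of `m₀`. -/
lemma exists_norm_ftP_unitBall_oscKernel_le {n : ℕ} (hn : 1 ≤ n) {α : ℝ} (hα : 0 < α)
    {Ω : En n → ℝ} (hΩ : ContinuousOn Ω {x : En n | x ≠ 0}) {M L : ℝ} (hM0 : 0 ≤ M) (hL0 : 0 ≤ L)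
    (hM : ∀ x ≠ 0, |Ω x| ≤ M)
    (hL : ∀ a : ℝ, 0 < a → ∀ x y : En n, a ≤ ‖x‖ → a ≤ ‖y‖ → |Ω x - Ω y| ≤ L / a * ‖x - y‖) :
    Integrable ({t : En n | ‖t‖ ≤ 1}.indicator (oscKernel n α Ω 1 1)) ∧
    ∃ C : ℝ, 0 ≤ C ∧ ∀ η : En n, η ≠ 0 →
      ‖ftP n ({t : En n | ‖t‖ ≤ 1}.indicator (oscKernel n α Ω 1 1)) η‖ ≤
        C * ‖η‖ ^ (-(min α 1 / (n + 2))) := by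
  obtain ⟨C₁, hC₁, hball⟩ := exists_integral_norm_rpow_le hn hα
  obtain ⟨C₂, hC₂, hshell⟩ := exists_norm_ftP_shell_oscKernel_le hn hα hΩ hM0 hL0 hM hL
  set K := oscKernel n α Ω 1 1 with hK
  have hdom : ∀ δ : ℝ, ∀ t : En n, ‖(closedBall (0 : En n) δ).indicator K t‖ ≤
      M * (closedBall (0 : En n) δ).indicator (fun x => ‖x‖ ^ (α - n)) t := fun δ t => by
    by_cases ht : t ∈ closedBall (0 : En n) δ
    · rw [indicator_of_mem ht, indicator_of_mem ht]
      exact norm_oscKernel_one_one_le hn α hM0 hM t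
    · simp [indicator_of_notMem ht]
  have hfint : ∀ δ : ℝ, 0 < δ → Integrable ((closedBall (0 : En n) δ).indicator K) := fun δ hδ =>
    ((hball δ hδ).1.const_mul M).mono'
      ((aestronglyMeasurable_oscKernel hn hα hΩ 1 1).indicator measurableSet_closedBall)
      (Eventually.of_forall (hdom δ))
  have hsmall : ∀ δ : ℝ, 0 < δ → ∀ η : En n,
      ‖ftP n ((closedBall (0 : En n) δ).indicator K) η‖ ≤ M * C₁ * δ ^ α := fun δ hδ η => by
    refine (norm_ftP_le_integral_norm _ η).trans ?_
    calc ∫ x, ‖(closedBall (0 : En n) δ).indicator K x‖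
        ≤ ∫ x, M * (closedBall (0 : En n) δ).indicator (fun x => ‖x‖ ^ (α - n)) x :=
          integral_mono (hfint δ hδ).norm ((hball δ hδ).1.const_mul M) (hdom δ)
      _ ≤ M * C₁ * δ ^ α := by
          rw [integral_const_mul, mul_assoc]
          gcongr
          exact (hball δ hδ).2
  have hset : {t : En n | ‖t‖ ≤ 1} = closedBall 0 1 := by ext t; simp
  rw [hset]
  set s₀ : ℝ := min α 1 / (n + 2) with hs₀
  have hmin : 0 < min α 1 := lt_min hα one_pos
  have hs₀0 : 0 < s₀ := by positivity
  refine ⟨hfint 1 one_pos, (M * C₁ + C₂) * Real.pi ^ s₀, by positivity, fun η hη => ?_⟩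
  have hη0 : 0 < ‖η‖ := norm_pos_iff.2 hη
  have hπη : Real.pi ^ s₀ * ‖η‖ ^ (-s₀) = (Real.pi / ‖η‖) ^ s₀ := by
    rw [Real.div_rpow Real.pi_pos.le hη0.le, Real.rpow_neg hη0.le, div_eq_mul_inv]
  rw [mul_assoc, hπη]
  rcases lt_or_ge ‖η‖ Real.pi with hlt | hge
  · calc _ ≤ M * C₁ * 1 ^ α := hsmall 1 one_pos η
      _ ≤ (M * C₁ + C₂) * 1 := by rw [Real.one_rpow]; linarith
      _ ≤ _ := by
        gcongr
        exact Real.one_le_rpow ((one_le_div hη0).2 hlt.le) hs₀0.le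
  · set ρ := Real.pi / ‖η‖ with hρ
    have hρ0 : 0 < ρ := by positivity
    have hρ1 : ρ ≤ 1 := (div_le_one hη0).2 hge
    set δ := ρ ^ ((n + 2 : ℝ)⁻¹) with hδ
    have hδ0 : 0 < δ := by positivity
    have hδ1 : δ ≤ 1 := Real.rpow_le_one hρ0.le hρ1 (by positivity)
    have hδρ : δ ^ (n + 2) = ρ := by
      rw [hδ, ← Real.rpow_natCast, ← Real.rpow_mul hρ0.le]
      push_cast
      rw [inv_mul_cancel₀ (by positivity), Real.rpow_one]
    have hδs : δ ^ min α 1 = ρ ^ s₀ := by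
      rw [hδ, ← Real.rpow_mul hρ0.le, hs₀]
      congr 1
      ring
    have hsplit : (closedBall (0 : En n) 1).indicator K = fun x =>
        (closedBall (0 : En n) δ).indicator K x +
          {x : En n | δ < ‖x‖ ∧ ‖x‖ ≤ 1}.indicator K x := by
      ext x
      rcases le_or_gt ‖x‖ δ with hx | hx
      · simp [indicator, hx, hx.trans hδ1, not_lt.2 hx]
      · simp [indicator, hx, not_le.2 hx]
    have hftP : ftP n ((closedBall (0 : En n) 1).indicator K) η =
        ftP n ((closedBall (0 : En n) δ).indicator K) η +
          ftP n ({x : En n | δ < ‖x‖ ∧ ‖x‖ ≤ 1}.indicator K) η := by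
      rw [hsplit]
      simp only [ftP, mul_add]
      exact integral_add (integrable_exp_mul (hfint δ hδ0) η) (integrable_exp_mul
        (integrable_indicator_shell_oscKernel hn hα hΩ hM 1 (by simp) hδ0) η)
    have hinv : (δ ^ (n + 1))⁻¹ / ‖η‖ ≤ δ := by
      have h1 : ‖η‖⁻¹ ≤ ρ := by
        rw [hρ, div_eq_mul_inv]
        exact le_mul_of_one_le_left (by positivity) (by linarith [Real.pi_gt_three])
      calc (δ ^ (n + 1))⁻¹ / ‖η‖ ≤ (δ ^ (n + 1))⁻¹ * δ ^ (n + 2) := by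
            rw [div_eq_mul_inv, hδρ]
            gcongr
        _ = δ := by rw [pow_succ δ (n + 1)]; field_simp
    have hα' : δ ^ α ≤ δ ^ min α 1 :=
      Real.rpow_le_rpow_of_exponent_ge hδ0 hδ1 (min_le_left _ _)
    have h1' : δ ≤ δ ^ min α 1 := by
      conv_lhs => rw [← Real.rpow_one δ]
      exact Real.rpow_le_rpow_of_exponent_ge hδ0 hδ1 (min_le_right _ _)
    calc _ ≤ M * C₁ * δ ^ α + C₂ * 1 * (δ ^ (n + 1))⁻¹ / ‖η‖ := by
          rw [hftP]
          exact (norm_add_le _ _).trans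
            (add_le_add (hsmall δ hδ0 η) (hshell 1 δ 1 le_rfl hδ0 hδ1 (by simp) η hge))
      _ = M * C₁ * δ ^ α + C₂ * ((δ ^ (n + 1))⁻¹ / ‖η‖) := by ring
      _ ≤ M * C₁ * δ ^ min α 1 + C₂ * δ ^ min α 1 := by
          gcongr
          exact hinv.trans h1'
      _ = (M * C₁ + C₂) * ρ ^ s₀ := by rw [hδs]; ring

lemma le_mul_rpow_mul_rpow {x E P Q θ : ℝ} (hx : 0 ≤ x) (hE : 0 ≤ E) (hP : 0 ≤ P) (hQ : 0 ≤ Q)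
    (hθ0 : 0 ≤ θ) (hθ1 : θ ≤ 1) (h1 : x ≤ E * P) (h2 : x ≤ E * Q) :
    x ≤ E * (P ^ (1 - θ) * Q ^ θ) := by
  have hsplit : ∀ y : ℝ, 0 ≤ y → y ^ (1 - θ) * y ^ θ = y := fun y hy => by
    rw [← Real.rpow_add_of_nonneg hy (by linarith) hθ0, sub_add_cancel, Real.rpow_one]
  calc x = x ^ (1 - θ) * x ^ θ := (hsplit x hx).symm
    _ ≤ (E * P) ^ (1 - θ) * (E * Q) ^ θ := by
        have : 0 ≤ 1 - θ := by linarith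
        gcongr
    _ = (E ^ (1 - θ) * E ^ θ) * (P ^ (1 - θ) * Q ^ θ) := by
        rw [Real.mul_rpow hE hP, Real.mul_rpow hE hQ]; ring
    _ = _ := by rw [hsplit E hE]

/-- Uniform bounds for the kernels of the multipliers with positive index. -/
lemma exists_norm_ftP_half_shell_oscKernel_le {n : ℕ} (hn : 1 ≤ n) {α : ℝ} (hα : 0 < α)
    (hα1 : α ≠ 1) {Ω : En n → ℝ} (hΩ : ContinuousOn Ω {x : En n | x ≠ 0})
    (hΩhom : ∀ c : ℝ, 0 < c → ∀ x : En n, Ω (c • x) = Ω x) {M L : ℝ} (hM0 : 0 ≤ M) (hL0 : 0 ≤ L)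
    (hM : ∀ x ≠ 0, |Ω x| ≤ M)
    (hL : ∀ a : ℝ, 0 < a → ∀ x y : En n, a ≤ ‖x‖ → a ≤ ‖y‖ → |Ω x - Ω y| ≤ L / a * ‖x - y‖) :
    ∃ E : ℝ, 0 ≤ E ∧ ∀ lam : ℝ, 1 ≤ lam → ∀ f : En n → ℂ,
      f = {x : En n | 1 / 2 < ‖x‖ ∧ ‖x‖ ≤ 1}.indicator (oscKernel n α Ω lam 0) →
      ∀ η : En n, η ≠ 0 → ‖ftP n f η‖ ≤ E * lam ^ (-(1 / 2) : ℝ) ∧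
        ‖ftP n f η‖ ≤ E * (lam * ‖η‖⁻¹) ∧
        ‖ftP n f η - ftP n f 0‖ ≤ E * lam ^ (-(1 / 2) : ℝ) ∧
        ‖ftP n f η - ftP n f 0‖ ≤ E * ‖η‖ := by
  obtain ⟨C₁, hC₁, hvdc⟩ := exists_norm_ftP_shell_oscKernel_le_sqrt hn hα hα1 hΩ hΩhom hM0 hM
  obtain ⟨C₂, hC₂, hshell⟩ := exists_norm_ftP_shell_oscKernel_le hn hα hΩ hM0 hL0 hM hL
  set V := volume.real {x : En n | 1 / 2 < ‖x‖ ∧ ‖x‖ ≤ 1} with hV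
  set N := 2 * ((1 / 2 : ℝ) ^ n)⁻¹ * M * V with hN
  have hN0 : 0 ≤ N := by positivity
  set C₃ := C₂ * (((1 / 2 : ℝ)) ^ (n + 1))⁻¹ with hC₃
  have hC₃0 : 0 ≤ C₃ := by positivity
  refine ⟨2 * C₁ + C₃ + N * Real.pi, by positivity, fun lam hlam f hf η hη => ?_⟩
  have hlam0 : 0 < lam := one_pos.trans_le hlam
  have hη0 : 0 < ‖η‖ := norm_pos_iff.2 hη
  have hNπ : N ≤ N * Real.pi := le_mul_of_one_le_right hN0 (by linarith [Real.pi_gt_three])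
  have hfint : Integrable f :=
    hf ▸ integrable_indicator_shell_oscKernel hn hα hΩ hM lam (by simp) one_half_pos
  have hL1 : ∫ x, ‖f x‖ ≤ N := by
    simp only [hf, norm_indicator_eq_indicator_norm]
    rw [integral_indicator (measurableSet_shell n _)]
    refine (le_abs_self _).trans ?_
    rw [← Real.norm_eq_abs]
    refine norm_setIntegral_le_of_norm_le_const (measure_shell_lt_top n _) fun x hx => ?_
    rw [norm_norm]
    exact norm_oscKernel_le α hM lam (by simp) one_half_pos hx.1.le
  have hsqrt : ∀ ξ, ‖ftP n f ξ‖ ≤ C₁ * lam ^ (-(1 / 2) : ℝ) := fun ξ => by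
    rw [Real.rpow_neg hlam0.le, ← Real.sqrt_eq_rpow, ← div_eq_mul_inv, hf]
    exact hvdc lam hlam0 ξ
  have hpow : 0 ≤ lam ^ (-(1 / 2) : ℝ) := by positivity
  refine ⟨(hsqrt η).trans (by gcongr; nlinarith [Real.pi_pos]), ?_, ?_, ?_⟩
  · rcases lt_or_ge ‖η‖ Real.pi with hlt | hge
    · calc ‖ftP n f η‖ ≤ N := (norm_ftP_le_integral_norm f η).trans hL1
        _ = N * ‖η‖ * (1 * ‖η‖⁻¹) := by field_simp
        _ ≤ (2 * C₁ + C₃ + N * Real.pi) * (lam * ‖η‖⁻¹) := by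
            gcongr
            have : N * ‖η‖ ≤ N * Real.pi := by gcongr
            linarith
    · calc ‖ftP n f η‖ ≤ C₂ * lam * ((1 / 2 : ℝ) ^ (n + 1))⁻¹ / ‖η‖ := by
            rw [hf]
            exact hshell lam (1 / 2) 0 hlam one_half_pos (by norm_num) (by simp) η hge
        _ = C₃ * (lam * ‖η‖⁻¹) := by rw [hC₃]; ring
        _ ≤ _ := by gcongr; linarith
  · calc _ ≤ ‖ftP n f η‖ + ‖ftP n f 0‖ := norm_sub_le _ _
      _ ≤ C₁ * lam ^ (-(1 / 2) : ℝ) + C₁ * lam ^ (-(1 / 2) : ℝ) :=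
          add_le_add (hsqrt η) (hsqrt 0)
      _ = 2 * C₁ * lam ^ (-(1 / 2) : ℝ) := by ring
      _ ≤ _ := by gcongr; linarith
  · refine (norm_ftP_sub_ftP_zero_le hfint (fun x hx => ?_) η).trans ?_
    · rw [hf, indicator_of_notMem fun h => absurd hx (not_lt.2 h.2)]
    · gcongr
      linarith

/-- Size of the multipliers `m̃_ℓ` and `m_ℓ` in terms of the frequency, with exponential gain. -/
lemma exists_multiplier_bounds {n : ℕ} (hn : 1 ≤ n) {α : ℝ} (hα : 0 < α) (hα1 : α ≠ 1)
    {Ω : En n → ℝ} (hΩsmooth : ContDiffOn ℝ (⊤ : ℕ∞) Ω {x : En n | x ≠ 0})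
    (hΩhom : ∀ c : ℝ, 0 < c → ∀ x : En n, Ω (c • x) = Ω x) :
    ∃ γ s B : ℝ, 0 < γ ∧ 0 < s ∧ s ≤ 1 / 2 ∧ 0 ≤ B ∧ ∀ (ℓ : ℕ) (η : En n), η ≠ 0 →
      ‖mMulTilde n α Ω ℓ η‖ ≤ B * (2 : ℝ) ^ (-(γ * ℓ)) * ‖η‖ ^ s ∧
      ‖mMul n α Ω ℓ η‖ ≤ B * (2 : ℝ) ^ (-(γ * ℓ)) * ‖η‖ ^ (-s) := by
  obtain ⟨M, L, hM0, hL0, hM, hL⟩ := exists_bound_lipschitz_of_homogeneous hΩsmooth hΩhom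
  have hΩ := hΩsmooth.continuousOn
  obtain ⟨hfint₀, C₀, hC₀, hdecay⟩ :=
    exists_norm_ftP_unitBall_oscKernel_le hn hα hΩ hM0 hL0 hM hL
  obtain ⟨E, hE, hpos⟩ :=
    exists_norm_ftP_half_shell_oscKernel_le hn hα hα1 hΩ hΩhom hM0 hL0 hM hL
  set s₀ : ℝ := min α 1 / (n + 2) with hs₀
  have hs₀0 : 0 < s₀ := by
    have : 0 < min α 1 := lt_min hα one_pos
    positivity
  set s := min s₀ (1 / 6) with hs
  have hs0 : 0 < s := lt_min hs₀0 (by norm_num)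
  have hs6 : s ≤ 1 / 6 := min_le_right _ _
  set f₀ := {t : En n | ‖t‖ ≤ 1}.indicator (oscKernel n α Ω 1 1) with hf₀
  have hsupp₀ : ∀ x, 1 < ‖x‖ → f₀ x = 0 := fun x hx => by
    simp [hf₀, not_le.2 hx]
  set N := ∫ x, ‖f₀ x‖ with hN
  have hN0 : 0 ≤ N := integral_nonneg fun _ => norm_nonneg _
  refine ⟨α / 4, s, E + C₀ + 2 * N, by positivity, hs0, by linarith, by positivity,
    fun ℓ η hη => ?_⟩
  have hη0 : 0 < ‖η‖ := norm_pos_iff.2 hη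
  rcases eq_or_ne ℓ 0 with rfl | hℓ
  · rw [mMulTilde_zero_eq_ftP hfint₀, mMul_zero_eq_ftP, ← hf₀, Nat.cast_zero, mul_zero, neg_zero,
      Real.rpow_zero, mul_one]
    have hbd : ∀ ξ, ‖ftP n f₀ ξ‖ ≤ N := norm_ftP_le_integral_norm f₀
    constructor
    · have h1 : ‖ftP n f₀ η - ftP n f₀ 0‖ ≤ (E + C₀ + 2 * N) * 1 :=
        (norm_sub_le _ _).trans (by linarith [hbd η, hbd 0])
      have h2 : ‖ftP n f₀ η - ftP n f₀ 0‖ ≤ (E + C₀ + 2 * N) * ‖η‖ :=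
        (norm_ftP_sub_ftP_zero_le hfint₀ hsupp₀ η).trans
          (by gcongr; linarith)
      simpa using le_mul_rpow_mul_rpow (norm_nonneg _) (by positivity) zero_le_one hη0.le hs0.le
        (by linarith) h1 h2
    · have h1 : ‖ftP n f₀ η‖ ≤ (E + C₀ + 2 * N) * 1 := (hbd η).trans (by linarith)
      have h2 : ‖ftP n f₀ η‖ ≤ (E + C₀ + 2 * N) * ‖η‖ ^ (-s₀) :=
        (hdecay η hη).trans (by gcongr; linarith)
      have := le_mul_rpow_mul_rpow (θ := s / s₀) (norm_nonneg _) (by positivity) zero_le_one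
        (by positivity) (by positivity) ((div_le_one hs₀0).2 (min_le_left _ _)) h1 h2
      rwa [Real.one_rpow, one_mul, ← Real.rpow_mul hη0.le, neg_mul, mul_div_cancel₀ _ hs₀0.ne']
        at this
  · set lam : ℝ := ((2 : ℝ) ^ ℓ) ^ α with hlam
    have hlam1 : 1 ≤ lam := Real.one_le_rpow (one_le_pow₀ one_le_two) hα.le
    have hlam0 : 0 < lam := one_pos.trans_le hlam1
    have hgain : lam ^ (-(1 / 4) : ℝ) = (2 : ℝ) ^ (-(α / 4 * ℓ)) := by
      rw [hlam, ← Real.rpow_natCast, ← Real.rpow_mul two_pos.le, ← Real.rpow_mul two_pos.le]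
      congr 1
      ring
    have hfint := integrable_indicator_shell_oscKernel hn hα hΩ hM lam (ε := 0) (by simp)
      one_half_pos
    obtain ⟨h1, h2, h3, h4⟩ := hpos lam hlam1 _ rfl η hη
    rw [mMulTilde_eq_ftP hℓ hfint, mMul_eq_ftP n α Ω hℓ, ← hgain]
    constructor
    · refine (le_mul_rpow_mul_rpow (norm_nonneg _) hE (by positivity) hη0.le hs0.le
        (by linarith) h3 h4).trans ?_
      rw [← Real.rpow_mul hlam0.le, mul_assoc]
      gcongr
      · linarith
      · linarith
    · refine (le_mul_rpow_mul_rpow (norm_nonneg _) hE (by positivity) (by positivity) hs0.le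
        (by linarith) h1 h2).trans ?_
      rw [← Real.rpow_mul hlam0.le, Real.mul_rpow hlam0.le (by positivity),
        ← mul_assoc (lam ^ _), ← Real.rpow_add hlam0, Real.inv_rpow hη0.le, ← Real.rpow_neg hη0.le, mul_assoc]
      gcongr
      · linarith
      · linarith

theorem statement9 (n : ℕ) (hn : 1 ≤ n) (α : ℝ) (hα : 0 < α) (hα1 : α ≠ 1)
    (Ω : En n → ℝ) (hΩsmooth : ContDiffOn ℝ (⊤ : ℕ∞) Ω {x : En n | x ≠ 0})
    (hΩhom : ∀ c : ℝ, 0 < c → ∀ x : En n, Ω (c • x) = Ω x)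
    (hΩmean : ∫ x : sphere (0 : En n) 1, Ω x ∂((volume : Measure (En n)).toSphere) = 0)
    (S : En n → ℝ) (hS0 : ∀ x, 0 ≤ S x) (hSsmooth : ContDiff ℝ (⊤ : ℕ∞) S)
    (hSsupp : ∀ x : En n, (∃ i, 1 < |x i|) → S x = 0) (hSint : ∫ x : En n, S x = 1) :
    ∃ γ : ℝ, 0 < γ ∧ ∃ C : ℝ≥0, ∀ j ℓ : ℕ, ∀ ξ : En n,
      (∑' k : ℤ,
          (‖ftP n (fun x => (DeltaFn n S x : ℂ)) ((2 : ℝ) ^ (-k + ℓ + j) • ξ) *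
              mMulTilde n α Ω ℓ ((2 : ℝ) ^ (-k + ℓ) • ξ)‖₊ : ℝ≥0∞) ^ (2 : ℝ)) ^
          ((1 : ℝ) / 2) +
        (∑' k : ℤ,
            (‖ftP n (fun x => (DeltaFn n S x : ℂ)) ((2 : ℝ) ^ (-k + ℓ - j) • ξ) *
                mMul n α Ω ℓ ((2 : ℝ) ^ (-k + ℓ) • ξ)‖₊ : ℝ≥0∞) ^ (2 : ℝ)) ^
          ((1 : ℝ) / 2) ≤
        C * ENNReal.ofReal ((2 : ℝ) ^ (-(γ * (ℓ + j)) : ℝ)) := by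
  obtain ⟨A, -, hD⟩ := exists_norm_ftP_DeltaFn_le hSsmooth hSsupp
  obtain ⟨C, hC, hsum⟩ := exists_dyadic_square_sum_le hD
  obtain ⟨γ, s, B, hγ, hs, hs2, hB, hbd⟩ := exists_multiplier_bounds hn hα hα1 hΩsmooth hΩhom
  refine ⟨min γ s, lt_min hγ hs, (2 * (C * B)).toNNReal, fun j ℓ ξ => ?_⟩
  have hexp : (2 : ℝ) ^ (-(γ * ℓ)) * (2 : ℝ) ^ (-(j * s)) ≤
      (2 : ℝ) ^ (-(min γ s * (ℓ + j))) := by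
    rw [← Real.rpow_add two_pos]
    refine Real.rpow_le_rpow_of_exponent_le one_le_two ?_
    have h1 : min γ s * ℓ ≤ γ * ℓ := by gcongr; exact min_le_left _ _
    have h2 : min γ s * j ≤ s * j := by gcongr; exact min_le_right _ _
    linarith
  have h1 := hsum (mMulTilde n α Ω ℓ) (B * (2 : ℝ) ^ (-(γ * ℓ))) s j ℓ (by positivity)
    (by rwa [abs_of_pos hs]) (fun η hη => (hbd ℓ η hη).1) ξ
  have h2 := hsum (mMul n α Ω ℓ) (B * (2 : ℝ) ^ (-(γ * ℓ))) (-s) (-j) ℓ (by positivity)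
    (by rwa [abs_neg, abs_of_pos hs]) (fun η hη => (hbd ℓ η hη).2) ξ
  push_cast at h1 h2
  rw [neg_mul_neg] at h2
  simp only [← sub_eq_add_neg] at h2
  refine (add_le_add h1 h2).trans ?_
  rw [← ENNReal.ofReal_add (by positivity) (by positivity), ← ENNReal.ofReal,
    ← ENNReal.ofReal_mul (by positivity)]
  refine ENNReal.ofReal_le_ofReal ?_
  calc _ = 2 * (C * B) * ((2 : ℝ) ^ (-(γ * ℓ)) * (2 : ℝ) ^ (-(j * s))) := by ring
    _ ≤ _ := by gcongr

end
end

section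
/- Let n = 1, α = 2 and K(t) = p.v. 1/t, so ℋ^{(u)}f(x) = p.v.∫_ℝ f(x−t) e^{iut²} dt/t. Let φ be a smooth test function (not identically zero) supported in {1/2 ≤ |ξ| ≤ 2} and define f_k for k ∈ ℤ by f̂_k(ξ) = φ(2^{−k}ξ). Then for every 1 < p < ∞ and 1 ≤ r < ∞ there is a constant c > 0 such that for all sufficiently large k, ‖V^r{ℋ^{(u)}f_k : u ∈ ℝ}‖_{L^p(ℝ)} ≥ c · 2^{k(−1 + 1/p + 2/r)}. -/
open MeasureTheory Filter Set Metric
open scoped ENNReal NNReal Topology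

noncomputable section

/-- The `r`-variation norm of a family of complex numbers indexed by `J ⊆ ι`. -/
def vNorm {ι : Type*} [LinearOrder ι] (r : ℝ) (J : Set ι) (a : ι → ℂ) : ℝ≥0∞ :=
  ⨆ (k : ℕ) (u : Fin (k + 1) → ι) (_ : StrictMono u) (_ : ∀ i, u i ∈ J),
    (∑ i : Fin k, (‖a (u i.succ) - a (u i.castSucc)‖₊ : ℝ≥0∞) ^ r) ^ (1 / r)

/-- ℋ^{(u)}f(x) = p.v. ∫ f(x−t) e^{iut²} dt/t on ℝ. -/
def pvH1 (u : ℝ) (f : ℝ → ℂ) (x : ℝ) : ℂ :=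
  limUnder (𝓝[>] (0 : ℝ)) fun ε =>
    ∫ t in {t : ℝ | ε < |t|},
      f (x - t) * Complex.exp (Complex.I * (u : ℂ) * (t : ℂ) ^ 2) / (t : ℂ)

/-- f_k, defined by f̂_k(ξ) = φ(2^{−k}ξ), i.e. f_k(x) = (2π)^{-1}∫ e^{ixξ} φ(2^{−k}ξ) dξ. -/
def fdil (φ : ℝ → ℂ) (k : ℕ) (x : ℝ) : ℂ :=
  (2 * Real.pi)⁻¹ •
    ∫ ξ : ℝ, Complex.exp (Complex.I * (x : ℂ) * (ξ : ℂ)) * φ ((2 : ℝ) ^ (-(k : ℤ)) * ξ)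

open scoped SchwartzMap FourierTransform

/-- The truncated integral `∫_{|t| > ε} f(x - t) e^{iut²} dt / t` whose limit defines `pvH1`. -/
def truncH (u : ℝ) (f : ℝ → ℂ) (x ε : ℝ) : ℂ :=
  ∫ t in {t : ℝ | ε < |t|},
    f (x - t) * Complex.exp (Complex.I * (u : ℂ) * (t : ℂ) ^ 2) / (t : ℂ)

theorem pvH1_eq_of_tendsto {u x : ℝ} {f : ℝ → ℂ} {L : ℂ}
    (h : Tendsto (truncH u f x) (𝓝[>] 0) (𝓝 L)) : pvH1 u f x = L :=
  h.limUnder_eq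

theorem measurableSet_lt_abs (ε : ℝ) : MeasurableSet {t : ℝ | ε < |t|} :=
  measurableSet_lt measurable_const measurable_id.abs

theorem norm_exp_I_mul_sq (u t : ℝ) :
    ‖Complex.exp (Complex.I * (u : ℂ) * (t : ℂ) ^ 2)‖ = 1 := by
  have : Complex.I * (u : ℂ) * (t : ℂ) ^ 2 = ((u * t ^ 2 : ℝ) : ℂ) * Complex.I := by
    push_cast; ring
  rw [this, Complex.norm_exp_ofReal_mul_I]

theorem norm_exp_I_mul_sq_sub_one_le (u t : ℝ) :
    ‖Complex.exp (Complex.I * (u : ℂ) * (t : ℂ) ^ 2) - 1‖ ≤ |u| * t ^ 2 := by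
  have : Complex.I * (u : ℂ) * (t : ℂ) ^ 2 = Complex.I * ((u * t ^ 2 : ℝ) : ℂ) := by
    push_cast; ring
  rw [this]
  refine Real.norm_exp_I_mul_ofReal_sub_one_le.trans_eq ?_
  rw [Real.norm_eq_abs, abs_mul, abs_of_nonneg (sq_nonneg t)]

theorem tendsto_setIntegral_lt_abs {Q : ℝ → ℂ} (hQ : Integrable Q) :
    Tendsto (fun ε => ∫ t in {t : ℝ | ε < |t|}, Q t) (𝓝[>] (0 : ℝ)) (𝓝 (∫ t, Q t)) := by
  simp_rw [← integral_indicator (measurableSet_lt_abs _)]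
  refine tendsto_integral_filter_of_dominated_convergence (fun t => ‖Q t‖) ?_ ?_ hQ.norm ?_
  · exact .of_forall fun ε => hQ.aestronglyMeasurable.indicator (measurableSet_lt_abs _)
  · exact .of_forall fun ε => .of_forall fun t => norm_indicator_le_norm_self _ _
  · filter_upwards [Measure.ae_ne volume (0 : ℝ)] with t ht
    refine tendsto_const_nhds.congr' ?_
    filter_upwards [mem_nhdsWithin_of_mem_nhds (Iio_mem_nhds (abs_pos.mpr ht))] with ε hε
    rw [indicator_of_mem]
    exact hε

theorem integrable_chirp (f : 𝓢(ℝ, ℂ)) (u x : ℝ) :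
    Integrable fun t : ℝ => f (x - t) * Complex.exp (Complex.I * (u : ℂ) * (t : ℂ) ^ 2) := by
  refine (f.integrable.comp_sub_left x).norm.mono' ?_ (.of_forall fun t => ?_)
  · exact (by fun_prop : Continuous _).aestronglyMeasurable
  · rw [norm_mul, norm_exp_I_mul_sq, mul_one]

theorem norm_integral_chirp_le (f : 𝓢(ℝ, ℂ)) (u x : ℝ) :
    ‖∫ t : ℝ, f (x - t) * Complex.exp (Complex.I * (u : ℂ) * (t : ℂ) ^ 2)‖ ≤ ∫ t, ‖f t‖ := by
  refine (norm_integral_le_integral_norm _).trans_eq ?_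
  simp_rw [norm_mul, norm_exp_I_mul_sq, mul_one]
  exact integral_sub_left_eq_self (fun t => ‖f t‖) volume x

theorem integrableOn_div_of_lt_abs {F : ℝ → ℂ} (hF : Integrable F) {ε : ℝ} (hε : 0 < ε) :
    IntegrableOn (fun t : ℝ => F t / (t : ℂ)) {t : ℝ | ε < |t|} := by
  refine Integrable.mono' (hF.norm.const_mul ε⁻¹).integrableOn ?_ ?_
  · exact (hF.aemeasurable.div
      Complex.measurable_ofReal.aemeasurable).aestronglyMeasurable.restrict
  · refine (ae_restrict_iff' (measurableSet_lt_abs _)).mpr (.of_forall fun t ht => ?_)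
    have ht' : ε < |t| := ht
    rw [norm_div, Complex.norm_real, Real.norm_eq_abs, div_eq_inv_mul]
    gcongr

theorem setIntegral_indicator_div_eq_zero (a : ℂ) (ε : ℝ) :
    ∫ t in {t : ℝ | ε < |t|}, (Icc (-1 : ℝ) 1).indicator (fun _ => a) t / (t : ℂ) = 0 := by
  rw [← integral_indicator (measurableSet_lt_abs _)]
  set G : ℝ → ℂ := {t : ℝ | ε < |t|}.indicator
    fun t => (Icc (-1 : ℝ) 1).indicator (fun _ => a) t / (t : ℂ) with hG
  have hodd : ∀ t, G (-t) = -G t := by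
    intro t
    simp only [hG, indicator_apply, mem_ofPred_eq, abs_neg, mem_Icc,
      Complex.ofReal_neg, div_neg]
    have h' : (-1 ≤ -t ∧ -t ≤ 1) ↔ (-1 ≤ t ∧ t ≤ 1) := by
      constructor <;> rintro ⟨h1, h2⟩ <;> constructor <;> linarith
    simp only [h']
    split_ifs <;> simp
  have h := integral_neg_eq_self G volume
  simp_rw [hodd, integral_neg] at h
  linear_combination (-1 / 2 : ℂ) * h

/-- Schwartz functions are Lipschitz. -/
theorem SchwartzMap.exists_norm_sub_le (f : 𝓢(ℝ, ℂ)) :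
    ∃ C, 0 ≤ C ∧ ∀ s t : ℝ, ‖f s - f t‖ ≤ C * |s - t| := by
  obtain ⟨C, hC⟩ := f.decay 0 1
  refine ⟨C, hC.1.le, fun s t => ?_⟩
  have := Convex.norm_image_sub_le_of_norm_deriv_le (f := f) (C := C) (s := univ) (x := t) (y := s)
    (fun y _ => f.differentiableAt) (fun y _ => ?_) convex_univ trivial trivial
  · simpa using this
  · simpa [norm_iteratedFDeriv_eq_norm_iteratedDeriv] using hC.2 y

theorem exists_tendsto_truncH (f : 𝓢(ℝ, ℂ)) :
    ∃ C, ∀ u x : ℝ, |u| ≤ 1 → ∃ L : ℂ, ‖L‖ ≤ C ∧ Tendsto (truncH u f x) (𝓝[>] 0) (𝓝 L) := by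
  obtain ⟨C₁, hC₁, hlip⟩ := f.exists_norm_sub_le
  set C₀ := SchwartzMap.seminorm ℝ 0 0 f
  have hC₀ : ∀ s, ‖f s‖ ≤ C₀ := f.norm_le_seminorm ℝ
  refine ⟨2 * (C₁ + C₀) + ∫ t, ‖f t‖, fun u x hu => ?_⟩
  set F : ℝ → ℂ := fun t => f (x - t) * Complex.exp (Complex.I * (u : ℂ) * (t : ℂ) ^ 2) with hF
  have hFint : Integrable F := integrable_chirp f u x
  have hFnorm : ∀ t, ‖F t‖ = ‖f (x - t)‖ := fun t => by
    simp only [hF, norm_mul, norm_exp_I_mul_sq, mul_one]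
  set A : ℝ → ℂ := (Icc (-1 : ℝ) 1).indicator fun _ => f x with hA
  have hAint : Integrable A :=
    (integrable_indicator_iff measurableSet_Icc).mpr (integrableOn_const (by simp))
  set Q : ℝ → ℂ := fun t => (F t - A t) / (t : ℂ) with hQ
  set B : ℝ → ℝ := fun t => (Icc (-1 : ℝ) 1).indicator (fun _ => C₁ + C₀) t + ‖f (x - t)‖ with hB
  have hBI : Integrable ((Icc (-1 : ℝ) 1).indicator (fun _ => C₁ + C₀)) :=
    (integrable_indicator_iff measurableSet_Icc).mpr (integrableOn_const (by simp))
  have hBint : Integrable B := hBI.add (f.integrable.comp_sub_left x).norm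
  have hBtot : ∫ t, B t = 2 * (C₁ + C₀) + ∫ t, ‖f t‖ := by
    rw [hB, integral_add hBI (f.integrable.comp_sub_left x).norm,
      integral_sub_left_eq_self (fun t => ‖f t‖) volume x, integral_indicator measurableSet_Icc,
      setIntegral_const]
    norm_num [Measure.real]
  have hQB : ∀ t, ‖Q t‖ ≤ B t := by
    intro t
    rcases eq_or_ne t 0 with rfl | ht0
    · simp only [hQ, hB, Complex.ofReal_zero, div_zero, norm_zero]
      have := hC₀ 0
      refine add_nonneg (indicator_nonneg (fun _ _ => ?_) _) (norm_nonneg _)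
      linarith [norm_nonneg (f 0)]
    have hpos : 0 < |t| := abs_pos.mpr ht0
    simp only [hQ, norm_div, Complex.norm_real, Real.norm_eq_abs]
    rw [div_le_iff₀ hpos]
    by_cases ht : t ∈ Icc (-1 : ℝ) 1
    · have ht1 : |t| ≤ 1 := abs_le.mpr ht
      simp only [hA, hB, indicator_of_mem ht]
      have hsplit : F t - f x = (f (x - t) - f x) *
          Complex.exp (Complex.I * (u : ℂ) * (t : ℂ) ^ 2) +
          f x * (Complex.exp (Complex.I * (u : ℂ) * (t : ℂ) ^ 2) - 1) := by
        simp only [hF]; ring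
      rw [hsplit]
      refine (norm_add_le _ _).trans ?_
      rw [norm_mul, norm_mul, norm_exp_I_mul_sq, mul_one]
      have h1 := hlip (x - t) x
      rw [show x - t - x = -t by ring, abs_neg] at h1
      have h2 : ‖Complex.exp (Complex.I * (u : ℂ) * (t : ℂ) ^ 2) - 1‖ ≤ |t| := by
        refine (norm_exp_I_mul_sq_sub_one_le u t).trans ?_
        rw [← sq_abs t]
        nlinarith [abs_nonneg u]
      have h3 : ‖f x‖ * ‖Complex.exp (Complex.I * (u : ℂ) * (t : ℂ) ^ 2) - 1‖ ≤ C₀ * |t| := by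
        gcongr
        exact hC₀ x
      nlinarith [norm_nonneg (f (x - t))]
    · have ht1 : 1 ≤ |t| := by
        by_contra! h
        exact ht (abs_le.mp h.le)
      simp only [hA, hB, indicator_of_notMem ht, sub_zero, zero_add, hFnorm]
      nlinarith [norm_nonneg (f (x - t))]
  have hQint : Integrable Q := hBint.mono'
    ((hFint.sub hAint).aemeasurable.div
      Complex.measurable_ofReal.aemeasurable).aestronglyMeasurable (.of_forall hQB)
  refine ⟨∫ t, Q t, ?_, (tendsto_setIntegral_lt_abs hQint).congr' ?_⟩
  · rw [← hBtot]
    exact norm_integral_le_of_norm_le hBint (.of_forall hQB)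
  · filter_upwards [self_mem_nhdsWithin] with ε hε
    have hε : 0 < ε := hε
    have h := integral_sub (integrableOn_div_of_lt_abs hFint hε)
      (integrableOn_div_of_lt_abs hAint hε)
    simp only [← sub_div] at h
    rw [hQ, h, hA, setIntegral_indicator_div_eq_zero, sub_zero]
    rfl

/-- Multiplication of a Schwartz function by the coordinate. -/
def SchwartzMap.coordMul (f : 𝓢(ℝ, ℂ)) : 𝓢(ℝ, ℂ) :=
  SchwartzMap.smulLeftCLM ℂ (fun s : ℝ => s) f

theorem SchwartzMap.coordMul_apply (f : 𝓢(ℝ, ℂ)) (s : ℝ) : f.coordMul s = (s : ℂ) * f s := by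
  rw [SchwartzMap.coordMul, SchwartzMap.smulLeftCLM_apply_apply (by fun_prop)]
  simp

theorem tendsto_truncH_of_coordMul (f : 𝓢(ℝ, ℂ)) {u x : ℝ} (hx : x ≠ 0) {L : ℂ}
    (hL : Tendsto (truncH u f.coordMul x) (𝓝[>] 0) (𝓝 L)) :
    Tendsto (truncH u f x) (𝓝[>] 0)
      (𝓝 ((x : ℂ)⁻¹ * ((∫ t : ℝ, f (x - t) *
        Complex.exp (Complex.I * (u : ℂ) * (t : ℂ) ^ 2)) + L))) := by
  refine (((tendsto_setIntegral_lt_abs (integrable_chirp f u x)).add hL).const_mul _).congr' ?_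
  filter_upwards [self_mem_nhdsWithin] with ε hε
  have hε : 0 < ε := hε
  rw [truncH, truncH, ← integral_add (integrable_chirp f u x).integrableOn
    (integrableOn_div_of_lt_abs (integrable_chirp _ u x) hε), ← integral_const_mul]
  refine setIntegral_congr_fun (measurableSet_lt_abs ε) fun t ht => ?_
  have ht0 : (t : ℂ) ≠ 0 := by
    have ht : ε < |t| := ht
    exact_mod_cast abs_pos.mp (hε.trans ht)
  have hx0 : (x : ℂ) ≠ 0 := by exact_mod_cast hx
  simp only [SchwartzMap.coordMul_apply]
  push_cast
  field_simp
  ring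

theorem norm_integral_chirp_sub_fourier_le (g : 𝓢(ℝ, ℂ)) (u x : ℝ) :
    ‖(∫ t : ℝ, g (x - t) * Complex.exp (Complex.I * (u : ℂ) * (t : ℂ) ^ 2)) -
        Complex.exp (Complex.I * (u : ℂ) * (x : ℂ) ^ 2) * 𝓕 (g : ℝ → ℂ) (u * x / Real.pi)‖ ≤
      |u| * ∫ s, ‖s‖ ^ 2 * ‖g s‖ := by
  have hπ : (Real.pi : ℂ) ≠ 0 := by exact_mod_cast Real.pi_ne_zero
  set e : ℝ → ℂ := fun s => Complex.exp (Complex.I * (u : ℂ) * (x : ℂ) ^ 2) *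
    Complex.exp (((-2 * Real.pi * s * (u * x / Real.pi) : ℝ) : ℂ) * Complex.I) with he
  have hen : ∀ s, ‖e s‖ = 1 := fun s => by
    rw [he, norm_mul, norm_exp_I_mul_sq, Complex.norm_exp_ofReal_mul_I, mul_one]
  have hexp : ∀ s : ℝ, Complex.exp (Complex.I * (u : ℂ) * ((x - s : ℝ) : ℂ) ^ 2) =
      e s * Complex.exp (Complex.I * (u : ℂ) * (s : ℂ) ^ 2) := by
    intro s
    simp only [he, ← Complex.exp_add]
    congr 1
    push_cast
    field_simp
    ring
  have h1 : ∫ t : ℝ, g (x - t) * Complex.exp (Complex.I * (u : ℂ) * (t : ℂ) ^ 2) =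
      ∫ s : ℝ, g s * (e s * Complex.exp (Complex.I * (u : ℂ) * (s : ℂ) ^ 2)) := by
    rw [← integral_sub_left_eq_self _ volume x]
    refine integral_congr_ae (.of_forall fun s => ?_)
    simp only [← hexp, sub_sub_cancel]
  have h2 : Complex.exp (Complex.I * (u : ℂ) * (x : ℂ) ^ 2) *
      𝓕 (g : ℝ → ℂ) (u * x / Real.pi) = ∫ s : ℝ, g s * e s := by
    rw [Real.fourier_real_eq_integral_exp_smul, ← integral_const_mul]
    refine integral_congr_ae (.of_forall fun s => ?_)
    simp only [he, smul_eq_mul]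
    ring
  have hec : Continuous e := by fun_prop
  have hi1 : Integrable fun s : ℝ => g s * (e s *
      Complex.exp (Complex.I * (u : ℂ) * (s : ℂ) ^ 2)) := by
    refine g.integrable.norm.mono' (by fun_prop : Continuous _).aestronglyMeasurable
      (.of_forall fun s => ?_)
    rw [norm_mul, norm_mul, hen, norm_exp_I_mul_sq, mul_one, mul_one]
  have hi2 : Integrable fun s : ℝ => g s * e s := by
    refine g.integrable.norm.mono' (by fun_prop : Continuous _).aestronglyMeasurable
      (.of_forall fun s => ?_)
    rw [norm_mul, hen, mul_one]
  rw [h1, h2, ← integral_sub hi1 hi2, ← integral_const_mul]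
  refine norm_integral_le_of_norm_le ((g.integrable_pow_mul volume 2).const_mul _)
    (.of_forall fun s => ?_)
  rw [show g s * (e s * Complex.exp (Complex.I * (u : ℂ) * (s : ℂ) ^ 2)) - g s * e s =
    g s * e s * (Complex.exp (Complex.I * (u : ℂ) * (s : ℂ) ^ 2) - 1) by ring,
    norm_mul, norm_mul, hen, mul_one]
  calc ‖g s‖ * _ ≤ ‖g s‖ * (|u| * s ^ 2) := by
        gcongr; exact norm_exp_I_mul_sq_sub_one_le u s
    _ = _ := by rw [Real.norm_eq_abs, sq_abs]; ring

/-- Stationary-phase type asymptotics of the truncated integrals of a Schwartz function. -/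
theorem exists_tendsto_truncH_asymptotic (g : 𝓢(ℝ, ℂ)) :
    ∃ C, 0 ≤ C ∧ ∀ u x : ℝ, |u| ≤ 1 → 1 ≤ x → ∃ L : ℂ,
      Tendsto (truncH u g x) (𝓝[>] 0) (𝓝 L) ∧
      ‖(x : ℂ) * L - Complex.exp (Complex.I * (u : ℂ) * (x : ℂ) ^ 2) *
        𝓕 (g : ℝ → ℂ) (u * x / Real.pi)‖ ≤ C * (|u| + x⁻¹) := by
  obtain ⟨C₂, hC₂⟩ := exists_tendsto_truncH g.coordMul.coordMul
  set A := ∫ s, ‖s‖ ^ 2 * ‖g s‖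
  set B := ∫ s, ‖g.coordMul s‖
  have hA : 0 ≤ A := integral_nonneg fun s => by positivity
  have hB : 0 ≤ B := integral_nonneg fun s => by positivity
  have hC₂0 : 0 ≤ C₂ := by
    obtain ⟨L, hL, -⟩ := hC₂ 0 0 (by simp)
    exact (norm_nonneg L).trans hL
  refine ⟨A + B + C₂, by positivity, fun u x hu hx => ?_⟩
  obtain ⟨L₂, hL₂, ht₂⟩ := hC₂ u x hu
  have hx0 : 0 < x := by linarith
  have hxC : (x : ℂ) ≠ 0 := by exact_mod_cast hx0.ne'
  refine ⟨_, tendsto_truncH_of_coordMul g hx0.ne'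
    (tendsto_truncH_of_coordMul g.coordMul hx0.ne' ht₂), ?_⟩
  rw [mul_inv_cancel_left₀ hxC, add_sub_right_comm]
  refine (norm_add_le _ _).trans ?_
  have h1 := norm_integral_chirp_sub_fourier_le g u x
  have h2 := norm_integral_chirp_le g.coordMul u x
  rw [norm_mul, norm_inv, Complex.norm_real, Real.norm_of_nonneg hx0.le]
  have h3 : x⁻¹ * ‖(∫ t : ℝ, g.coordMul (x - t) *
      Complex.exp (Complex.I * (u : ℂ) * (t : ℂ) ^ 2)) + L₂‖ ≤ x⁻¹ * (B + C₂) := by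
    gcongr
    exact (norm_add_le _ _).trans (add_le_add h2 hL₂)
  have h4 : 0 ≤ A * x⁻¹ := by positivity
  have h5 : 0 ≤ (B + C₂) * |u| := by positivity
  linarith

theorem exists_oscillation (g : 𝓢(ℝ, ℂ)) {η : ℝ} (hη : 𝓕 (g : ℝ → ℂ) η ≠ 0) :
    ∃ c N₀ : ℝ, 0 < c ∧ ∀ N : ℝ, N₀ ≤ N → ∃ J : ℕ, c * N ≤ J ∧ ∀ x ∈ Icc N (2 * N),
      ∃ (u : ℕ → ℝ) (L : ℕ → ℂ), StrictMono u ∧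
        (∀ j ≤ J, Tendsto (truncH (u j) g x) (𝓝[>] 0) (𝓝 (L j))) ∧
        ∀ j < J, c / N ≤ ‖L (j + 1) - L j‖ := by
  obtain ⟨C, hC, hasymp⟩ := exists_tendsto_truncH_asymptotic g
  set ψ : ℝ → ℂ := 𝓕 (g : ℝ → ℂ) with hψ
  have hψc : Continuous ψ := by
    rw [hψ, ← SchwartzMap.fourier_coe]; exact (𝓕 g).continuous
  set a := ‖ψ η‖
  have ha : 0 < a := norm_pos_iff.mpr hη
  obtain ⟨δ', hδ', hball⟩ := Metric.continuousAt_iff.mp hψc.continuousAt (a / 4) (by positivity)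
  set δ := δ' / 2
  have hδ : 0 < δ := by positivity
  have hnear : ∀ y, |y| ≤ δ → ‖ψ (η + y) - ψ η‖ ≤ a / 4 := fun y hy => by
    rw [← dist_eq_norm]
    refine (hball ?_).le
    rw [Real.dist_eq, add_sub_cancel_left]
    exact hy.trans_lt (half_lt_self hδ')
  set M := Real.pi * (|η| + δ) with hM
  have hM0 : 0 < M := by have := Real.pi_pos; positivity
  refine ⟨min (δ / 2) (a / 2), max (max 1 M) (max (2 / δ) (4 * (C * (M + 1)) / a)), by positivity,
    fun N hN => ?_⟩
  obtain ⟨⟨hN1, hNM⟩, hNδ, hNa⟩ : (1 ≤ N ∧ M ≤ N) ∧ 2 / δ ≤ N ∧ 4 * (C * (M + 1)) / a ≤ N := by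
    simpa [max_le_iff] using hN
  have hN0 : 0 < N := by linarith
  refine ⟨⌊δ * N⌋₊, ?_, fun x hx => ?_⟩
  · have h1 := Nat.lt_floor_add_one (δ * N)
    have h2 : 2 ≤ N * δ := (div_le_iff₀ hδ).mp hNδ
    have h3 : min (δ / 2) (a / 2) * N ≤ δ / 2 * N := by gcongr; exact min_le_left _ _
    linarith
  have hx0 : 0 < x := hN0.trans_le hx.1
  have hxC : (x : ℂ) ≠ 0 := by exact_mod_cast hx0.ne'
  set u : ℕ → ℝ := fun j => Real.pi * (η + j / x) / x with hu
  have hjx : ∀ j : ℕ, j ≤ ⌊δ * N⌋₊ → |(j : ℝ) / x| ≤ δ := fun j hj => by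
    rw [abs_of_nonneg (by positivity), div_le_iff₀ hx0]
    calc (j : ℝ) ≤ δ * N := (Nat.le_floor_iff (by positivity)).mp hj
      _ ≤ δ * x := by gcongr; exact hx.1
  have hub : ∀ j : ℕ, j ≤ ⌊δ * N⌋₊ → |u j| ≤ M / x := fun j hj => by
    simp only [hu]
    rw [abs_div, abs_mul, abs_of_pos Real.pi_pos, abs_of_pos hx0, hM]
    have := Real.pi_pos
    gcongr
    exact (abs_add_le _ _).trans (by gcongr; exact hjx j hj)
  have hex : ∀ j : ℕ, ∃ L : ℂ, j ≤ ⌊δ * N⌋₊ → Tendsto (truncH (u j) g x) (𝓝[>] 0) (𝓝 L) ∧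
      ‖(x : ℂ) * L - Complex.exp (Complex.I * (u j : ℂ) * (x : ℂ) ^ 2) * ψ (η + j / x)‖
        ≤ a / 4 := by
    intro j
    by_cases hj : j ≤ ⌊δ * N⌋₊
    · obtain ⟨L, hL, hb⟩ := hasymp (u j) x ((hub j hj).trans
        ((div_le_one hx0).mpr (hNM.trans hx.1))) (hN1.trans hx.1)
      refine ⟨L, fun _ => ⟨hL, ?_⟩⟩
      have harg : u j * x / Real.pi = η + j / x := by
        have := Real.pi_pos
        simp only [hu]; field_simp
      rw [harg] at hb
      refine hb.trans ?_
      calc C * (|u j| + x⁻¹) ≤ C * (M / x + x⁻¹) := by gcongr; exact hub j hj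
        _ = C * (M + 1) / x := by field_simp
        _ ≤ a / 4 := by
          rw [div_le_iff₀ hx0]
          have h1 := (div_le_iff₀ ha).mp hNa
          have h2 : N * a ≤ x * a := by gcongr; exact hx.1
          linarith
    · exact ⟨0, fun h => absurd h hj⟩
  choose L hL using hex
  refine ⟨u, L, ?_, fun j hj => (hL j hj).1, fun j hj => ?_⟩
  · intro i j hij
    have := Real.pi_pos
    have hij' : (i : ℝ) < j := by exact_mod_cast hij
    simp only [hu]
    gcongr
  set w : ℂ := Complex.exp (Complex.I * (u j : ℂ) * (x : ℂ) ^ 2) with hw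
  have hwn : ‖w‖ = 1 := norm_exp_I_mul_sq _ _
  have hwsucc : Complex.exp (Complex.I * (u (j + 1) : ℂ) * (x : ℂ) ^ 2) = -w := by
    have : Complex.I * (u (j + 1) : ℂ) * (x : ℂ) ^ 2 =
        Complex.I * (u j : ℂ) * (x : ℂ) ^ 2 + Real.pi * Complex.I := by
      simp only [hu]; push_cast; field_simp; ring
    rw [this, Complex.exp_add, Complex.exp_pi_mul_I, mul_neg_one]
  have h1 := (hL j hj.le).2
  have h2 := (hL (j + 1) hj).2
  rw [hwsucc] at h2
  have h3 := hnear _ (hjx j hj.le)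
  have h4 := hnear _ (hjx (j + 1) hj)
  have h5 : ‖2 * w * ψ η‖ = 2 * a := by
    rw [norm_mul, norm_mul, hwn, mul_one, Complex.norm_two]
  have h6 : 2 * w * ψ η =
      ((x : ℂ) * L (j + 1) - -w * ψ (η + ((j + 1 : ℕ) : ℝ) / x))
      - ((x : ℂ) * L j - w * ψ (η + (j : ℝ) / x))
      - w * (ψ (η + ((j + 1 : ℕ) : ℝ) / x) - ψ η)
      - w * (ψ (η + (j : ℝ) / x) - ψ η) - (x : ℂ) * (L (j + 1) - L j) := by
    ring
  have h7 : a ≤ x * ‖L (j + 1) - L j‖ := by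
    have hb : ∀ z : ℂ, ‖w * z‖ = ‖z‖ := fun z => by rw [norm_mul, hwn, one_mul]
    have hx' : ‖(x : ℂ) * (L (j + 1) - L j)‖ = x * ‖L (j + 1) - L j‖ := by
      rw [norm_mul, Complex.norm_real, Real.norm_of_nonneg hx0.le]
    rw [← hb] at h3 h4
    rw [h6] at h5
    have hle := h5.symm.le.trans ((norm_sub_le _ _).trans (add_le_add_left ((norm_sub_le _ _).trans
      (add_le_add_left ((norm_sub_le _ _).trans (add_le_add_left (norm_sub_le _ _) _)) _)) _))
    linarith
  rw [div_le_iff₀ hN0]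
  have h8 : x * ‖L (j + 1) - L j‖ ≤ 2 * N * ‖L (j + 1) - L j‖ := by gcongr; exact hx.2
  have h9 := min_le_right (δ / 2) (a / 2)
  linarith

theorem truncH_dilate (u : ℝ) (g : ℝ → ℂ) (x ε : ℝ) {l : ℝ} (hl : 0 < l) :
    truncH u (fun y => (l : ℂ) * g (l * y)) x ε = l * truncH (u / l ^ 2) g (l * x) (l * ε) := by
  have hl0 : (l : ℂ) ≠ 0 := by exact_mod_cast hl.ne'
  have h := Measure.integral_comp_mul_left ({t : ℝ | l * ε < |t|}.indicator fun t : ℝ =>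
    g (l * x - t) * Complex.exp (Complex.I * ((u / l ^ 2 : ℝ) : ℂ) * (t : ℂ) ^ 2) / (t : ℂ)) l
  rw [truncH, truncH, ← integral_indicator (measurableSet_lt_abs _),
    ← integral_indicator (measurableSet_lt_abs _)]
  rw [abs_of_pos (inv_pos.mpr hl), eq_inv_smul_iff₀ hl.ne', Complex.real_smul] at h
  rw [← h, ← mul_assoc, ← integral_const_mul]
  refine integral_congr_ae (.of_forall fun t => ?_)
  have hmem : l * ε < |l * t| ↔ ε < |t| := by
    rw [abs_mul, abs_of_pos hl, mul_lt_mul_iff_right₀ hl]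
  simp only [indicator_apply, mem_ofPred_eq, hmem]
  split_ifs
  · have harg : Complex.I * ((u / l ^ 2 : ℝ) : ℂ) * ((l * t : ℝ) : ℂ) ^ 2 =
        Complex.I * (u : ℂ) * (t : ℂ) ^ 2 := by
      push_cast; field_simp
    rw [harg, ← mul_sub]
    push_cast
    field_simp
  · simp

theorem tendsto_truncH_dilate {u x l : ℝ} {g : ℝ → ℂ} {L : ℂ} (hl : 0 < l)
    (h : Tendsto (truncH u g (l * x)) (𝓝[>] 0) (𝓝 L)) :
    Tendsto (truncH (l ^ 2 * u) (fun y => (l : ℂ) * g (l * y)) x) (𝓝[>] 0) (𝓝 (l * L)) := by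
  have hscale : Tendsto (fun ε : ℝ => l * ε) (𝓝[>] 0) (𝓝[>] 0) := by
    refine tendsto_nhdsWithin_iff.mpr ⟨?_, ?_⟩
    · refine tendsto_nhdsWithin_of_tendsto_nhds ?_
      simpa using (continuous_const_mul l).tendsto 0
    · filter_upwards [self_mem_nhdsWithin] with ε hε
      exact mul_pos hl hε
  refine ((h.comp hscale).const_mul (l : ℂ)).congr fun ε => ?_
  rw [truncH_dilate _ _ _ _ hl, mul_div_cancel_left₀ _ (by positivity)]
  rfl

theorem exists_schwartz_fdil_eq {φ : ℝ → ℂ} (hφsmooth : ContDiff ℝ (⊤ : ℕ∞) φ)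
    (hφ : HasCompactSupport φ) :
    ∃ g : 𝓢(ℝ, ℂ), (∀ η, 𝓕 (g : ℝ → ℂ) η = φ (2 * Real.pi * η)) ∧
      ∀ k : ℕ, fdil φ k = fun x => (((2 : ℝ) ^ k : ℝ) : ℂ) * g ((2 : ℝ) ^ k * x) := by
  have hπ := Real.pi_pos
  set ψ : ℝ → ℂ := fun η => φ (2 * Real.pi * η) with hψ
  have hψsupp : HasCompactSupport ψ :=
    hφ.comp_homeomorph (Homeomorph.mulLeft₀ (2 * Real.pi) (by positivity))
  have hψsmooth : ContDiff ℝ (⊤ : ℕ∞) ψ := by fun_prop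
  set Ψ : 𝓢(ℝ, ℂ) := hψsupp.toSchwartzMap hψsmooth with hΨ
  refine ⟨𝓕⁻ Ψ, fun η => ?_, fun k => funext fun x => ?_⟩
  · rw [← SchwartzMap.fourier_coe, FourierTransform.fourier_fourierInv_eq]
    rfl
  · rw [SchwartzMap.fourierInv_coe, Real.fourierInv_eq', fdil]
    have ha : (0 : ℝ) < 2 * Real.pi * 2 ^ k := by positivity
    have h := Measure.integral_comp_mul_left (fun ξ : ℝ =>
      Complex.exp (Complex.I * (x : ℂ) * (ξ : ℂ)) * φ ((2 : ℝ) ^ (-(k : ℤ)) * ξ))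
      (2 * Real.pi * 2 ^ k)
    rw [abs_of_pos (inv_pos.mpr ha), eq_inv_smul_iff₀ ha.ne'] at h
    rw [← h, smul_smul, inv_mul_cancel_left₀ (by positivity), Complex.real_smul]
    congr 1
    refine integral_congr_ae (.of_forall fun ξ => ?_)
    have harg : (2 : ℝ) ^ (-(k : ℤ)) * (2 * Real.pi * 2 ^ k * ξ) = 2 * Real.pi * ξ := by
      rw [zpow_neg, zpow_natCast]; field_simp
    have hΨξ : Ψ ξ = φ (2 * Real.pi * ξ) := rfl
    simp only [harg, hΨξ, smul_eq_mul]
    congr 2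
    simp
    ring

theorem le_vNorm_of_le_norm_sub {r : ℝ} (hr : 0 < r) {a : ℝ → ℂ} {J : ℕ} {u : ℕ → ℝ}
    (hu : StrictMono u) {b : ℝ}
    (h : ∀ j < J, b ≤ ‖a (u (j + 1)) - a (u j)‖) :
    ENNReal.ofReal ((J : ℝ) ^ (1 / r) * b) ≤ vNorm r univ a := by
  rw [vNorm]
  refine le_iSup_of_le J (le_iSup_of_le (fun i => u i) (le_iSup_of_le
    (fun i j hij => hu hij) (le_iSup_of_le (fun _ => trivial) ?_)))
  have hsum : (J : ℝ≥0∞) * ENNReal.ofReal b ^ r ≤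
      ∑ i : Fin J, (‖a (u i.succ) - a (u i.castSucc)‖₊ : ℝ≥0∞) ^ r := by
    calc (J : ℝ≥0∞) * ENNReal.ofReal b ^ r = ∑ _i : Fin J, ENNReal.ofReal b ^ r := by simp
      _ ≤ _ := by
        gcongr with i
        rw [← enorm_eq_nnnorm, ← ofReal_norm]
        exact ENNReal.ofReal_le_ofReal (h i i.isLt)
  refine le_trans ?_ (ENNReal.rpow_le_rpow hsum (by positivity))
  rw [ENNReal.mul_rpow_of_nonneg _ _ (by positivity), ← ENNReal.rpow_mul,
    mul_one_div_cancel hr.ne', ENNReal.rpow_one, ENNReal.ofReal_mul (by positivity),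
    ← ENNReal.ofReal_rpow_of_nonneg (by positivity) (by positivity), ENNReal.ofReal_natCast]

theorem ofReal_mul_rpow_le_lintegral_rpow {p : ℝ} (hp : 0 < p) {V : ℝ → ℝ≥0∞} {A b : ℝ}
    (hA : 0 ≤ A) (hb : 0 ≤ b)
    (h : ∀ x ∈ Icc A (2 * A), ENNReal.ofReal b ≤ V x) :
    ENNReal.ofReal (b * A ^ (1 / p)) ≤ (∫⁻ x, V x ^ p) ^ (1 / p) := by
  have hint : ENNReal.ofReal b ^ p * ENNReal.ofReal A ≤ ∫⁻ x, V x ^ p := by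
    calc ENNReal.ofReal b ^ p * ENNReal.ofReal A
        = ∫⁻ x, (Icc A (2 * A)).indicator (fun _ => ENNReal.ofReal b ^ p) x := by
          rw [lintegral_indicator_const measurableSet_Icc, Real.volume_Icc]
          congr 2; ring
      _ ≤ _ := by
        refine lintegral_mono fun x => ?_
        exact indicator_le (g := fun y => V y ^ p)
          (fun y hy => ENNReal.rpow_le_rpow (h y hy) hp.le) x
  refine le_trans ?_ (ENNReal.rpow_le_rpow hint (by positivity))
  rw [ENNReal.mul_rpow_of_nonneg _ _ (by positivity), ← ENNReal.rpow_mul,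
    mul_one_div_cancel hp.ne', ENNReal.rpow_one, ENNReal.ofReal_mul hb,
    ← ENNReal.ofReal_rpow_of_nonneg hA (by positivity)]

theorem statement15 (φ : ℝ → ℂ) (hφsmooth : ContDiff ℝ (⊤ : ℕ∞) φ)
    (hφsupp : ∀ ξ : ℝ, ¬(1 / 2 ≤ |ξ| ∧ |ξ| ≤ 2) → φ ξ = 0) (hφne : φ ≠ 0)
    (p r : ℝ) (hp1 : 1 < p) (hr : 1 ≤ r) :
    ∃ c : ℝ, 0 < c ∧ ∃ k₀ : ℕ, ∀ k : ℕ, k₀ ≤ k →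
      ENNReal.ofReal (c * (2 : ℝ) ^ ((k : ℝ) * (-1 + 1 / p + 2 / r))) ≤
        (∫⁻ x : ℝ, (vNorm r Set.univ fun u => pvH1 u (fdil φ k) x) ^ p) ^ (1 / p) := by
  have hφ : HasCompactSupport φ := by
    refine HasCompactSupport.intro (isCompact_Icc (a := -2) (b := 2)) fun ξ hξ => ?_
    exact hφsupp ξ fun h => hξ (abs_le.mp h.2)
  obtain ⟨g, hg, hfdil⟩ := exists_schwartz_fdil_eq hφsmooth hφ
  obtain ⟨ξ, hξ⟩ := Function.ne_iff.mp hφne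
  have hη : 𝓕 (g : ℝ → ℂ) (ξ / (2 * Real.pi)) ≠ 0 := by
    rw [hg, mul_div_cancel₀ _ (by have := Real.pi_pos; positivity)]
    exact hξ
  obtain ⟨c, N₀, hc, hosc⟩ := exists_oscillation g hη
  have hr0 : 0 < r := by linarith
  refine ⟨c ^ (1 / r) * c, by positivity, ⌈N₀⌉₊, fun k hk => ?_⟩
  set l : ℝ := 2 ^ k with hl
  have hl1 : 1 ≤ l := one_le_pow₀ (by norm_num)
  have hl0 : 0 < l := by linarith
  have hN : N₀ ≤ l ^ 2 := by
    have h1 : N₀ ≤ k := (Nat.le_ceil N₀).trans (by exact_mod_cast hk)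
    have h2 : (k : ℝ) < l := by
      rw [hl]; exact_mod_cast Nat.lt_two_pow_self (n := k)
    nlinarith
  obtain ⟨J, hJ, hJx⟩ := hosc (l ^ 2) hN
  have hV : ∀ x ∈ Icc l (2 * l), ENNReal.ofReal ((J : ℝ) ^ (1 / r) * (c / l)) ≤
      vNorm r Set.univ fun u => pvH1 u (fdil φ k) x := by
    intro x hx
    obtain ⟨u, L, hu, hlim, hdiff⟩ := hJx (l * x) ⟨by nlinarith [hx.1], by nlinarith [hx.2]⟩
    refine le_vNorm_of_le_norm_sub hr0 (u := fun j => l ^ 2 * u j)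
      (fun i j hij => by have := hu hij; dsimp only; gcongr) fun j hj => ?_
    rw [hfdil, pvH1_eq_of_tendsto (tendsto_truncH_dilate hl0 (hlim (j + 1) hj)),
      pvH1_eq_of_tendsto (tendsto_truncH_dilate hl0 (hlim j hj.le)), ← mul_sub, norm_mul,
      Complex.norm_real, Real.norm_of_nonneg hl0.le]
    calc c / l = l * (c / l ^ 2) := by field_simp
      _ ≤ _ := by gcongr; exact hdiff j hj
  refine le_trans (ENNReal.ofReal_le_ofReal ?_)
    (ofReal_mul_rpow_le_lintegral_rpow (by linarith) hl0.le (by positivity) hV)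
  calc c ^ (1 / r) * c * (2 : ℝ) ^ ((k : ℝ) * (-1 + 1 / p + 2 / r))
      = (c * l ^ 2) ^ (1 / r) * (c / l) * l ^ (1 / p) := by
        rw [Real.mul_rpow hc.le (by positivity), Real.rpow_mul (by norm_num), Real.rpow_natCast,
          ← hl, Real.rpow_add hl0, Real.rpow_add hl0, Real.rpow_neg_one, ← Real.rpow_natCast l 2,
          ← Real.rpow_mul hl0.le]
        push_cast
        rw [mul_one_div]
        ring
    _ ≤ _ := by gcongr

end
end
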